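/- Let (G, L) be an instance of MLCM in which no line is a subpath of another line, and let l1, l2 be an overlapping pair of lines without a separator whose common subpath has the minimum number of edges among all such pairs. If (G, L) admits a crossing-free solution, then it admits a crossing-free solution in which l1 and l2 are immediate neighbors (no line lies between them) in the line orders on every edge of their common subpath. -/

import Mathlib

/-!
Core model for metro-line crossing minimization (MLCM).

An embedded graph is a symmetric loopless graph together with, for each
vertex, a list of its neighbours in clockwise order (the embedding).
A line is a simple path in the graph.  A line layout assigns to each
ordered pair `(u, v)` forming an edge the clockwise order `ord u v` in
which the lines through `{u, v}` meet the port of `u`.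
-/

structure EmbeddedGraph (V : Type) where
  adj : V → V → Prop
  symm : ∀ {u v}, adj u v → adj v u
  loopless : ∀ v, ¬ adj v v
  rot : V → List V
  rot_mem : ∀ u v, v ∈ rot u ↔ adj u v
  rot_nodup : ∀ u, (rot u).Nodup

/-- `p` is a simple path (with at least one edge) in `G`. -/
def EmbeddedGraph.IsPath {V : Type} (G : EmbeddedGraph V) (p : List V) : Prop :=
  p.Nodup ∧ 2 ≤ p.length ∧ p.Chain' G.adj

/-- An instance of MLCM: an embedded graph together with a set of lines
(indexed by `ι`), each a simple path. -/
structure MLCMInstance (V ι : Type) where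
  G : EmbeddedGraph V
  line : ι → List V
  line_path : ∀ i, G.IsPath (line i)

namespace MLCMInstance

variable {V ι : Type}

/-- Line `i` passes through the edge `{u, v}`. -/
def usesEdge (M : MLCMInstance V ι) (i : ι) (u v : V) : Prop :=
  [u, v] <:+: M.line i ∨ [v, u] <:+: M.line i

/-- `u` is a terminal (an endpoint) of line `i`. -/
def Terminal (M : MLCMInstance V ι) (i : ι) (u : V) : Prop :=
  (M.line i).head? = some u ∨ (M.line i).getLast? = some u

/-- A line layout: for each ordered pair `(u, v)`, the clockwise order
(at the port of `u`) of the lines through the edge `{u, v}`. -/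
structure Layout (M : MLCMInstance V ι) where
  ord : V → V → List ι
  nodup : ∀ u v, (ord u v).Nodup
  mem_iff : ∀ u v i, i ∈ ord u v ↔ M.usesEdge i u v

variable {M : MLCMInstance V ι}

/-- Lines `i` and `j` have an edge crossing on the edge `{u, v}`:
they appear in the same relative order in both port orders. -/
def EdgeCross (lay : M.Layout) (i j : ι) (u v : V) : Prop :=
  i ≠ j ∧ List.Sublist [i, j] (lay.ord u v) ∧ List.Sublist [i, j] (lay.ord v u)

/-- The cyclic concatenation of the port orders at `u`, following the
clockwise order of the edges incident to `u`. -/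
def cyclicAt (lay : M.Layout) (u : V) : List ι :=
  (M.G.rot u).flatMap fun w => lay.ord u w

/-- Lines `i` and `j` have a vertex crossing at `u`: they alternate
`… i … j … i … j …` in the cyclic concatenation of the port orders. -/
def VertexCross (lay : M.Layout) (i j : ι) (u : V) : Prop :=
  i ≠ j ∧ ∃ n, List.Sublist [i, j, i, j] ((cyclicAt lay u).rotate n)

/-- Lines `i` and `j` cross in the layout. -/
def Crosses (lay : M.Layout) (i j : ι) : Prop :=
  (∃ u v, EdgeCross lay i j u v ∨ EdgeCross lay j i u v) ∨
  (∃ u, VertexCross lay i j u ∨ VertexCross lay j i u)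

/-- The pair of lines `i, j` has an unavoidable crossing: the lines
cross in every line layout. -/
def Unavoidable (M : MLCMInstance V ι) (i j : ι) : Prop :=
  ∀ lay : M.Layout, Crosses lay i j

/-- A vertex crossing of `i, j` at `u` is unavoidable: it occurs in
every line layout. -/
def UnavoidableVC (M : MLCMInstance V ι) (i j : ι) (u : V) : Prop :=
  ∀ lay : M.Layout, VertexCross lay i j u ∨ VertexCross lay j i u

/-- A layout is feasible when it contains no avoidable vertex crossings. -/
def Feasible (lay : M.Layout) : Prop :=
  ∀ i j u, VertexCross lay i j u → M.UnavoidableVC i j u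

/-- A layout is crossing-free when no two lines cross in it. -/
def CrossingFree (lay : M.Layout) : Prop :=
  ∀ i j, i ≠ j → ¬ Crosses lay i j

/-- The periphery condition: at every port the lines terminating at that
vertex occupy the outermost positions of the port order. -/
def Periphery (lay : M.Layout) : Prop :=
  ∀ u v, ∃ s₁ s₂ s₃ : List ι, lay.ord u v = s₁ ++ s₂ ++ s₃ ∧
    (∀ i ∈ s₁, M.Terminal i u) ∧ (∀ i ∈ s₂, ¬ M.Terminal i u) ∧
    (∀ i ∈ s₃, M.Terminal i u)

/-- `P` occurs as a (contiguous) subpath of line `i` (in either direction). -/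
def InfixOf (M : MLCMInstance V ι) (i : ι) (P : List V) : Prop :=
  P <:+: M.line i ∨ P.reverse <:+: M.line i

/-- `P` is a common subpath (with at least one edge) of lines `i` and `j`. -/
def CommonSubpath (M : MLCMInstance V ι) (i j : ι) (P : List V) : Prop :=
  2 ≤ P.length ∧ M.InfixOf i P ∧ M.InfixOf j P

/-- `P` is the (maximal) common subpath of lines `i` and `j`. -/
def MaxCommonSubpath (M : MLCMInstance V ι) (i j : ι) (P : List V) : Prop :=
  M.CommonSubpath i j P ∧ ∀ Q, M.CommonSubpath i j Q → Q.length ≤ P.length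

/-- No line is a subpath of another line. -/
def ProperLines (M : MLCMInstance V ι) : Prop :=
  ∀ i j, i ≠ j → ¬ M.InfixOf j (M.line i)

/-- Relative to the edge directed from `u` to `v`: line `i` is above
line `j` in every crossing-free solution. -/
def MustAbove (M : MLCMInstance V ι) (i j : ι) (u v : V) : Prop :=
  ∀ lay : M.Layout, Feasible lay → CrossingFree lay → List.Sublist [i, j] (lay.ord u v)

/-- `i, j` is an overlapping pair with common subpath `P` from `u` to `v`:
`i` has its terminal at `u`, and `j` has its terminal at `v`. -/
def OverlappingPair (M : MLCMInstance V ι) (i j : ι) (P : List V) (u v : V) : Prop :=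
  i ≠ j ∧ M.MaxCommonSubpath i j P ∧ P.head? = some u ∧ P.getLast? = some v ∧
    M.Terminal i u ∧ M.Terminal j v ∧ ¬ M.Terminal i v ∧ ¬ M.Terminal j u

/-- `l` is a separator of the overlapping pair `i, j` with common subpath `P`:
on `P`, in every crossing-free solution, `l` lies between `i` and `j`. -/
def Separator (M : MLCMInstance V ι) (i j : ι) (P : List V) (l : ι) : Prop :=
  l ≠ i ∧ l ≠ j ∧ ∃ u v, [u, v] <:+: P ∧
    ((M.MustAbove i l u v ∧ M.MustAbove l j u v) ∨
     (M.MustAbove j l u v ∧ M.MustAbove l i u v))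

end MLCMInstance

/-- `g` comes before `h` in the list `L`. -/
abbrev Precedes {ι : Type} (L : List ι) (g h : ι) : Prop := List.Sublist [g, h] L

namespace Precedes

variable {ι : Type} {L : List ι} {g h k : ι}

theorem cons_iff {x : ι} : Precedes (x :: L) g h ↔ Precedes L g h ∨ (g = x ∧ h ∈ L) := by
  simp only [Precedes, List.sublist_cons_iff, List.cons.injEq]
  constructor
  · rintro (h1 | ⟨r, ⟨rfl, rfl⟩, h2⟩)
    · exact Or.inl h1
    · exact Or.inr ⟨rfl, by simpa using h2⟩
  · rintro (h1 | ⟨rfl, h2⟩)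
    · exact Or.inl h1
    · exact Or.inr ⟨[h], ⟨rfl, rfl⟩, by simpa using h2⟩

theorem not_nil : ¬ Precedes ([] : List ι) g h := by simp [Precedes]

theorem left_mem (hp : Precedes L g h) : g ∈ L := hp.subset (by simp)

theorem right_mem (hp : Precedes L g h) : h ∈ L := hp.subset (by simp)

theorem append_iff {K : List ι} :
    Precedes (L ++ K) g h ↔ Precedes L g h ∨ Precedes K g h ∨ (g ∈ L ∧ h ∈ K) := by
  induction L with
  | nil => simp
  | cons x L ih =>
    simp only [List.cons_append, cons_iff, ih, List.mem_append, List.mem_cons]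
    have := @right_mem ι K g h
    tauto

theorem filter_iff {p : ι → Bool} : Precedes (L.filter p) g h ↔ Precedes L g h ∧ p g ∧ p h := by
  induction L with
  | nil => simp
  | cons x L ih =>
    rw [List.filter_cons]
    split
    · simp only [cons_iff, ih, List.mem_filter]
      grind
    · simp only [cons_iff, ih]
      grind

theorem reverse_iff : Precedes L.reverse g h ↔ Precedes L h g := by
  have := @List.reverse_sublist ι [h, g] L
  simpa [Precedes] using this

theorem ne (hL : L.Nodup) (hp : Precedes L g h) : g ≠ h := by
  have := hp.nodup hL
  simpa using this

theorem asymm (hL : L.Nodup) (h₁ : Precedes L g h) (h₂ : Precedes L h g) : False := by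
  induction L with
  | nil => exact not_nil h₁
  | cons x L ih =>
    rw [cons_iff] at h₁ h₂
    have := @left_mem ι L
    have := @right_mem ι L
    grind

theorem trans (hL : L.Nodup) (h₁ : Precedes L g h) (h₂ : Precedes L h k) : Precedes L g k := by
  induction L with
  | nil => exact absurd h₁ not_nil
  | cons x L ih =>
    rw [cons_iff] at h₁ h₂ ⊢
    have := @left_mem ι L
    have := @right_mem ι L
    grind

theorem total (hg : g ∈ L) (hh : h ∈ L) (hne : g ≠ h) : Precedes L g h ∨ Precedes L h g := by
  induction L with
  | nil => simp at hg
  | cons x L ih =>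
    rw [cons_iff, cons_iff]
    grind

theorem eq_append_singleton (hL : L.Nodup) (hg : g ∈ L)
    (hlast : ∀ h ∈ L, h ≠ g → Precedes L h g) : ∃ A, L = A ++ [g] := by
  obtain ⟨A, B, rfl⟩ := List.append_of_mem hg
  cases B with
  | nil => exact ⟨A, rfl⟩
  | cons b B =>
    have hgb : Precedes (A ++ g :: b :: B) g b := by
      rw [append_iff, cons_iff]; simp
    exact (asymm hL hgb (hlast b (by simp) (ne hL hgb).symm)).elim

theorem eq_cons (hL : L.Nodup) (hg : g ∈ L)
    (hfirst : ∀ h ∈ L, h ≠ g → Precedes L g h) : ∃ A, L = g :: A := by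
  obtain ⟨A, B, rfl⟩ := List.append_of_mem hg
  cases A with
  | nil => exact ⟨B, rfl⟩
  | cons a A =>
    have hag : Precedes (a :: A ++ g :: B) a g := by
      rw [append_iff]; simp
    exact (asymm hL hag (hfirst a (by simp) (ne hL hag))).elim

end Precedes

open Classical in
/-- The reordering of `L` that moves the elements satisfying `p` directly behind `a`, provided
they all precede `a`, and keeps the relative order otherwise. -/
noncomputable def moveBehind {ι : Type} (a : ι) (p : ι → Prop) (L : List ι) : List ι :=
  L.filter (fun x => ¬ (p x ∨ Precedes L a x)) ++ L.filter (fun x => p x ∨ Precedes L a x)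

section MoveBehind

variable {ι : Type} {a : ι} {p : ι → Prop} {L : List ι} {g h : ι}

theorem moveBehind_perm : (moveBehind a p L).Perm L := by
  classical
  refine List.perm_append_comm.trans ?_
  simpa only [decide_not] using List.filter_append_perm (fun x => decide (p x ∨ Precedes L a x)) L

theorem moveBehind_flip_iff (hL : L.Nodup) (ha : a ∈ L) :
    (Precedes L g h ∧ Precedes (moveBehind a p L) h g) ↔
      Precedes L g h ∧ p g ∧ ¬ p h ∧ (h = a ∨ Precedes L h a) := by
  classical
  simp only [moveBehind, Precedes.append_iff, Precedes.filter_iff, List.mem_filter,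
    decide_eq_true_eq]
  refine and_congr_right fun hgh => ?_
  have h₁ : ¬ Precedes L h g := fun h' => hgh.asymm hL h'
  have h₂ : Precedes L a g → Precedes L a h := fun h' => h'.trans hL hgh
  have h₃ : Precedes L a h → h = a ∨ Precedes L h a → False := by
    rintro h' (rfl | h'')
    · exact h'.ne hL rfl
    · exact h'.asymm hL h''
  have h₄ : h ≠ a → Precedes L h a ∨ Precedes L a h := Precedes.total hgh.right_mem ha
  have h₅ := hgh.left_mem
  have h₆ := hgh.right_mem
  constructor
  · rintro (⟨h', -⟩ | ⟨h', -⟩ | ⟨⟨-, h'⟩, -, h''⟩)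
    · exact (h₁ h').elim
    · exact (h₁ h').elim
    · have h₇ : ¬ Precedes L a h := fun hc => h' (Or.inr hc)
      refine ⟨h''.resolve_right fun hc => h₇ (h₂ hc), fun hc => h' (Or.inl hc), ?_⟩
      by_cases hha : h = a
      · exact Or.inl hha
      · exact Or.inr ((h₄ hha).resolve_right h₇)
  · rintro ⟨hg, hh, h'⟩
    exact Or.inr (Or.inr ⟨⟨h₆, fun hc => hc.elim hh fun hc => h₃ hc h'⟩, h₅, Or.inl hg⟩)

theorem moveBehind_infix (hL : L.Nodup) (ha : a ∈ L) (hpa : ∀ x, p x → Precedes L x a)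
    (hg : p g) (hgL : g ∈ L) (hfirst : ∀ x ∈ L, p x → x ≠ g → Precedes L g x) :
    [a, g] <:+: moveBehind a p L := by
  classical
  have h₁ : ∃ A, L.filter (fun x => ¬ (p x ∨ Precedes L a x)) = A ++ [a] := by
    refine Precedes.eq_append_singleton (hL.filter _) ?_ ?_
    · simp only [List.mem_filter, ha, true_and, decide_eq_true_eq]
      rintro (h | h)
      · exact (hpa a h).ne hL rfl
      · exact h.ne hL rfl
    · intro h hh hne
      simp only [List.mem_filter, decide_eq_true_eq, Precedes.filter_iff] at hh ⊢
      have := Precedes.total hh.1 ha hne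
      have h1 : ¬ p a := fun h => (hpa a h).ne hL rfl
      have h2 : ¬ Precedes L a a := fun h => h.ne hL rfl
      tauto
  have h₂ : ∃ A, L.filter (fun x => p x ∨ Precedes L a x) = g :: A := by
    refine Precedes.eq_cons (hL.filter _) ?_ ?_
    · simp [hgL, hg]
    · intro h hh hne
      simp only [List.mem_filter, decide_eq_true_eq, Precedes.filter_iff] at hh ⊢
      refine ⟨?_, Or.inl hg, hh.2⟩
      rcases hh.2 with h' | h'
      · exact hfirst h hh.1 h' hne
      · exact (hpa g hg).trans hL h'
  obtain ⟨A, hA⟩ := h₁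
  obtain ⟨B, hB⟩ := h₂
  refine ⟨A, B, ?_⟩
  rw [moveBehind, hA, hB]
  simp

end MoveBehind

/-- The path with edge relation `U` and set of endpoints `T` visits the vertices
`f 0, …, f N` in this order. -/
structure LinePath {V : Type} (U : V → V → Prop) (T : V → Prop) (N : ℕ) (f : ℕ → V) : Prop where
  inj : ∀ {a b}, a ≤ N → b ≤ N → f a = f b → a = b
  uses : ∀ x y, U x y ↔ ∃ k < N, (x = f k ∧ y = f (k + 1)) ∨ (x = f (k + 1) ∧ y = f k)
  term : ∀ x, T x ↔ x = f 0 ∨ x = f N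

namespace LinePath

variable {V : Type} {U : V → V → Prop} {T : V → Prop} {N : ℕ} {f : ℕ → V}

theorem uses_succ (h : LinePath U T N f) {k : ℕ} (hk : k < N) : U (f k) (f (k + 1)) :=
  (h.uses _ _).2 ⟨k, hk, Or.inl ⟨rfl, rfl⟩⟩

theorem symm (h : LinePath U T N f) {x y : V} (hxy : U x y) : U y x := by
  obtain ⟨k, hk, hk'⟩ := (h.uses _ _).1 hxy
  exact (h.uses _ _).2 ⟨k, hk, by tauto⟩

theorem uses_left (h : LinePath U T N f) {k : ℕ} {y : V} (hk : k ≤ N) (hy : U (f k) y) :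
    (k < N ∧ y = f (k + 1)) ∨ (1 ≤ k ∧ y = f (k - 1)) := by
  obtain ⟨l, hl, ⟨h₁, h₂⟩ | ⟨h₁, h₂⟩⟩ := (h.uses _ _).1 hy
  · obtain rfl := h.inj hk hl.le h₁
    exact Or.inl ⟨hl, h₂⟩
  · obtain rfl := h.inj hk hl h₁
    exact Or.inr ⟨by omega, by simpa using h₂⟩

theorem eq_of_uses (h : LinePath U T N f) {x y : V} (hy : U x y) : ∃ k ≤ N, x = f k := by
  obtain ⟨l, hl, ⟨h₁, h₂⟩ | ⟨h₁, h₂⟩⟩ := (h.uses _ _).1 hy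
  exacts [⟨l, hl.le, h₁⟩, ⟨l + 1, hl, h₁⟩]

theorem degree_le_two (h : LinePath U T N f) {x c d e : V} (hc : U x c) (hd : U x d)
    (hcd : c ≠ d) (he : U x e) : e = c ∨ e = d := by
  obtain ⟨k, hk, rfl⟩ := h.eq_of_uses hc
  have := h.uses_left hk hc
  have := h.uses_left hk hd
  have := h.uses_left hk he
  grind

theorem term_unique (h : LinePath U T N f) {x c d : V} (hx : T x) (hc : U x c) (hd : U x d) :
    c = d := by
  rcases (h.term _).1 hx with rfl | rfl
  · have := h.uses_left (Nat.zero_le _) hc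
    have := h.uses_left (Nat.zero_le _) hd
    grind
  · have := h.uses_left le_rfl hc
    have := h.uses_left le_rfl hd
    grind

theorem reverse (h : LinePath U T N f) : LinePath U T N (fun k => f (N - k)) where
  inj := by
    intro a b ha hb hab
    have := h.inj (by omega) (by omega) hab
    omega
  uses := by
    intro x y
    rw [h.uses]
    constructor
    · rintro ⟨k, hk, hk'⟩
      refine ⟨N - (k + 1), by omega, ?_⟩
      rw [show N - (N - (k + 1)) = k + 1 by omega, show N - (N - (k + 1) + 1) = k by omega]
      tauto
    · rintro ⟨k, hk, hk'⟩
      refine ⟨N - (k + 1), by omega, ?_⟩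
      rw [show N - k = N - (k + 1) + 1 by omega] at hk'
      tauto
  term := by
    intro x
    rw [h.term]
    simp [or_comm]

/-- A path that uses the edges of the injective sequence `g` and agrees with `g` on the first of
them follows `g`. -/
theorem follow_from (h : LinePath U T N f) {g : ℕ → V} {K c : ℕ}
    (hg : ∀ {a b}, a ≤ K → b ≤ K → g a = g b → a = b)
    (hU : ∀ k < K, U (g k) (g (k + 1))) (hK : 1 ≤ K) (hc : c + 1 ≤ N) (h0 : f c = g 0)
    (h1 : f (c + 1) = g 1) : c + K ≤ N ∧ ∀ k ≤ K, f (c + k) = g k := by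
  have key : ∀ k, k + 1 ≤ K → c + (k + 1) ≤ N ∧ ∀ l ≤ k + 1, f (c + l) = g l := by
    intro k
    induction k with
    | zero =>
      intro _
      refine ⟨hc, fun l hl => ?_⟩
      obtain rfl | rfl : l = 0 ∨ l = 1 := by omega
      exacts [h0, h1]
    | succ k ih =>
      intro hk
      obtain ⟨hkN, hfg⟩ := ih (by omega)
      have hu := hU (k + 1) (by omega)
      rw [← hfg (k + 1) le_rfl] at hu
      rcases h.uses_left hkN hu with ⟨h₁, h₂⟩ | ⟨h₁, h₂⟩
      · refine ⟨h₁, fun l hl => ?_⟩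
        rcases Nat.lt_or_ge (k + 1) l with hl' | hl'
        · obtain rfl : l = k + 1 + 1 := by omega
          exact h₂.symm
        · exact hfg l hl'
      · rw [show c + (k + 1) - 1 = c + k by omega, hfg k (by omega)] at h₂
        have := hg (by omega) (by omega) h₂
        omega
  simpa [Nat.sub_add_cancel hK] using key (K - 1) (by omega)

/-- A path that starts at `g 0` and uses the edges of the injective sequence `g` follows it. -/
theorem follow (h : LinePath U T N f) {g : ℕ → V} {K : ℕ}
    (hg : ∀ {a b}, a ≤ K → b ≤ K → g a = g b → a = b)
    (hU : ∀ k < K, U (g k) (g (k + 1))) (h0 : f 0 = g 0) :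
    K ≤ N ∧ ∀ k ≤ K, f k = g k := by
  rcases Nat.eq_zero_or_pos K with rfl | hK
  · exact ⟨Nat.zero_le _, fun k hk => by rwa [Nat.le_zero.1 hk]⟩
  · have hu := hU 0 hK
    rw [← h0] at hu
    rcases h.uses_left (Nat.zero_le _) hu with ⟨h₁, h₂⟩ | ⟨h₁, -⟩
    · simpa using h.follow_from hg hU hK (c := 0) h₁ h0 h₂.symm
    · omega

theorem exists_ne_uses (h : LinePath U T N f) {x c : V} (hc : U x c) (hx : ¬ T x) :
    ∃ d ≠ c, U x d := by
  obtain ⟨k, hk, rfl⟩ := h.eq_of_uses hc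
  have h0 : k ≠ 0 := by
    rintro rfl
    exact hx ((h.term _).2 (Or.inl rfl))
  have hN : k ≠ N := by
    rintro rfl
    exact hx ((h.term _).2 (Or.inr rfl))
  have h₁ := h.uses_succ (k := k) (by omega)
  have h₂ := h.symm (h.uses_succ (k := k - 1) (by omega))
  rw [Nat.sub_add_cancel (by omega)] at h₂
  by_contra! hcon
  have h₃ := (not_imp_not.1 (hcon _) h₁).trans (not_imp_not.1 (hcon _) h₂).symm
  have := h.inj (by omega) (by omega) h₃
  omega

theorem exists_start (h : LinePath U T N f) {x : V} (hx : T x) :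
    ∃ f', LinePath U T N f' ∧ f' 0 = x := by
  rcases (h.term _).1 hx with rfl | rfl
  · exact ⟨f, h, rfl⟩
  · exact ⟨_, h.reverse, rfl⟩

theorem not_term (h : LinePath U T N f) {x c d : V} (hc : U x c) (hd : U x d) (hcd : c ≠ d) :
    ¬ T x := fun hx => hcd (h.term_unique hx hc hd)

end LinePath

/-- A family of lines, given by their edge relations `U` and terminals `T`, with a set `S` of
admissible assignments of line orders to the ordered pairs of vertices. -/
structure LineSystem {V ι : Type} (U : ι → V → V → Prop) (T : ι → V → Prop)
    (S : (V → V → List ι) → Prop) : Prop where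
  exists_path : ∀ l, ∃ N f, LinePath (U l) (T l) N f
  proper : ∀ {l l'}, l ≠ l' → ¬ ∀ x y, U l' x y → U l x y
  mem : ∀ {o}, S o → ∀ x y l, l ∈ o x y ↔ U l x y
  nodup : ∀ {o}, S o → ∀ x y, (o x y).Nodup
  rev : ∀ {o}, S o → ∀ x y, o y x = (o x y).reverse
  pass : ∀ {o}, S o → ∀ {x c d g h}, U g x c → U h x c → U g x d → U h x d → c ≠ d →
    Precedes (o c x) g h → Precedes (o x d) g h
  split : ∀ {o o'}, S o → S o' → ∀ {x c g h}, Precedes (o x c) g h → Precedes (o' x c) h g →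
    T g x ∨ T h x ∨ ∃ d ≠ c, U g x d ∧ U h x d
  modify : ∀ {o o'}, S o → (∀ x y, (o' x y).Perm (o x y)) → (∀ x y, o' y x = (o' x y).reverse) →
    (∀ x c g h, Precedes (o x c) g h → Precedes (o' x c) h g →
      T g x ∨ T h x ∨ ∃ d ≠ c, Precedes (o x d) h g ∧ Precedes (o' x d) g h) → S o'

namespace LineSystem

variable {V ι : Type} {U : ι → V → V → Prop} {T : ι → V → Prop} {S : (V → V → List ι) → Prop}
  {o o' : V → V → List ι} {g h l : ι} {x y c d : V} {α : ℕ → V}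

theorem symm (H : LineSystem U T S) (hl : U l x y) : U l y x := by
  obtain ⟨N, f, hf⟩ := H.exists_path l
  exact hf.symm hl

theorem degree_le_two (H : LineSystem U T S) {e : V} (hc : U l x c) (hd : U l x d)
    (hcd : c ≠ d) (he : U l x e) : e = c ∨ e = d := by
  obtain ⟨N, f, hf⟩ := H.exists_path l
  exact hf.degree_le_two hc hd hcd he

theorem not_term (H : LineSystem U T S) (hc : U l x c) (hd : U l x d) (hcd : c ≠ d) :
    ¬ T l x := by
  obtain ⟨N, f, hf⟩ := H.exists_path l
  exact hf.not_term hc hd hcd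

theorem precedes_rev (H : LineSystem U T S) (ho : S o) :
    Precedes (o y x) g h ↔ Precedes (o x y) h g := by
  rw [H.rev ho x y, Precedes.reverse_iff]

theorem left_uses (H : LineSystem U T S) (ho : S o) (hgh : Precedes (o x y) g h) : U g x y :=
  (H.mem ho _ _ _).1 hgh.left_mem

theorem right_uses (H : LineSystem U T S) (ho : S o) (hgh : Precedes (o x y) g h) : U h x y :=
  (H.mem ho _ _ _).1 hgh.right_mem

theorem total (H : LineSystem U T S) (ho : S o) (hg : U g x y) (hh : U h x y) (hne : g ≠ h) :
    Precedes (o x y) g h ∨ Precedes (o x y) h g :=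
  Precedes.total ((H.mem ho _ _ _).2 hg) ((H.mem ho _ _ _).2 hh) hne

/-- Along a walk used by two lines, their relative order does not change. -/
theorem precedes_along (H : LineSystem U T S) (ho : S o) {m a b : ℕ}
    (hα : ∀ {a b}, a ≤ m → b ≤ m → α a = α b → a = b) (hab : a ≤ b) (hb : b < m)
    (hg : ∀ k, a ≤ k → k ≤ b → U g (α k) (α (k + 1)))
    (hh : ∀ k, a ≤ k → k ≤ b → U h (α k) (α (k + 1))) :
    Precedes (o (α a) (α (a + 1))) g h ↔ Precedes (o (α b) (α (b + 1))) g h := by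
  induction b, hab using Nat.le_induction with
  | base => rfl
  | succ b hab ih =>
    rw [ih (by omega) (fun k h₁ h₂ => hg k h₁ (by omega)) (fun k h₁ h₂ => hh k h₁ (by omega))]
    have hne : α b ≠ α (b + 1 + 1) := fun he => by
      have := hα (by omega) (by omega) he
      omega
    have g₁ := hg b hab (by omega)
    have h₁ := hh b hab (by omega)
    have g₂ := hg (b + 1) (by omega) le_rfl
    have h₂ := hh (b + 1) (by omega) le_rfl
    constructor
    · exact H.pass ho (H.symm g₁) (H.symm h₁) g₂ h₂ hne
    · intro hp
      rcases H.total ho g₁ h₁ (hp.ne (H.nodup ho _ _)) with hp' | hp'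
      · exact hp'
      · exact (hp.asymm (H.nodup ho _ _)
          (H.pass ho (H.symm h₁) (H.symm g₁) h₂ g₂ hne hp')).elim

/-- The order of two lines that diverge at `x` is the same in all admissible orders. -/
theorem always_of_diverge (H : LineSystem U T S) (ho : S o) (hp : Precedes (o x c) g h)
    (hg : ¬ T g x) (hh : ¬ T h x) (hd : ∀ d ≠ c, U g x d → ¬ U h x d) (ho' : S o') :
    Precedes (o' x c) g h := by
  rcases H.total ho' (H.left_uses ho hp) (H.right_uses ho hp) (hp.ne (H.nodup ho _ _)) with h' | h'
  · exact h'
  · rcases H.split ho ho' hp h' with h₁ | h₁ | ⟨d, hd₁, hd₂, hd₃⟩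
    · exact (hg h₁).elim
    · exact (hh h₁).elim
    · exact (hd d hd₁ hd₂ hd₃).elim

theorem always_of_left_diverge (H : LineSystem U T S) (ho : S o) (hp : Precedes (o x c) g h)
    (hcd : d ≠ c) (hh : U h x d) (hg : ¬ T g x) (hg' : ¬ U g x d) (ho' : S o') :
    Precedes (o' x c) g h := by
  refine H.always_of_diverge ho hp hg (H.not_term (H.right_uses ho hp) hh hcd.symm) ?_ ho'
  intro e he hge hhe
  rcases H.degree_le_two (H.right_uses ho hp) hh hcd.symm hhe with rfl | rfl
  exacts [he rfl, hg' hge]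

theorem always_of_right_diverge (H : LineSystem U T S) (ho : S o) (hp : Precedes (o x c) g h)
    (hcd : d ≠ c) (hg : U g x d) (hh : ¬ T h x) (hh' : ¬ U h x d) (ho' : S o') :
    Precedes (o' x c) g h := by
  refine H.always_of_diverge ho hp (H.not_term (H.left_uses ho hp) hg hcd.symm) hh ?_ ho'
  intro e he hge hhe
  rcases H.degree_le_two (H.left_uses ho hp) hg hcd.symm hge with rfl | rfl
  exacts [he rfl, hh' hhe]

end LineSystem

/-- Line `l` has a terminal at `α k₀` for some `k₀ ≤ k` and follows `α` from there to
`α (q + 1)`. -/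
def StartsOn {V : Type} (U : V → V → Prop) (T : V → Prop) (α : ℕ → V) (q k : ℕ) : Prop :=
  ∃ k₀ ≤ k, T (α k₀) ∧ ∀ n, k₀ ≤ n → n ≤ q → U (α n) (α (n + 1))

/-- The line `a` visits `α 0, …, α (q + 1)`, the line `i` starts at `α s` and follows `a` to its
end, and the position of `i` before `a` is not enforced by any line. -/
structure OvertakeConfig {V ι : Type} (U : ι → V → V → Prop) (T : ι → V → Prop)
    (S : (V → V → List ι) → Prop) (o : V → V → List ι) (i a : ι) (q s : ℕ) (α : ℕ → V) :
    Prop where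
  sys : LineSystem U T S
  adm : S o
  path : LinePath (U a) (T a) (q + 1) α
  start_le : s ≤ q
  start : T i (α s)
  uses : ∀ k, s ≤ k → k ≤ q → U i (α k) (α (k + 1))
  before : Precedes (o (α s) (α (s + 1))) i a
  not_separated : ∀ l k, s ≤ k → k ≤ q →
    (∀ o', S o' → Precedes (o' (α k) (α (k + 1))) i l) →
    (∀ o', S o' → Precedes (o' (α k) (α (k + 1))) l a) → False
  covering : ∀ l, (∀ k, s ≤ k → k ≤ q → U l (α k) (α (k + 1))) → ¬ T l (α (q + 1)) →
    Precedes (o (α q) (α (q + 1))) i l → Precedes (o (α q) (α (q + 1))) l a →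
    ∀ o', S o' → Precedes (o' (α q) (α (q + 1))) i l

namespace OvertakeConfig

variable {V ι : Type} {U : ι → V → V → Prop} {T : ι → V → Prop} {S : (V → V → List ι) → Prop}
  {o : V → V → List ι} {i a : ι} {q s : ℕ} {α : ℕ → V} {k k₀ : ℕ} {y w : ι}

/-- The lines that `a` overtakes on the edge from `α k` to `α (k + 1)`. -/
def Overtaken (U : ι → V → V → Prop) (T : ι → V → Prop) (o : V → V → List ι) (i a : ι) (q : ℕ)
    (α : ℕ → V) (k : ℕ) (y : ι) : Prop :=
  StartsOn (U y) (T y) α q k ∧ (y = i ∨ Precedes (o (α q) (α (q + 1))) i y) ∧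
    Precedes (o (α q) (α (q + 1))) y a

/-- The pairs of lines whose order changes on the edge from `α k` to `α (k + 1)`. -/
def Flipped (U : ι → V → V → Prop) (T : ι → V → Prop) (o : V → V → List ι) (i a : ι) (q : ℕ)
    (α : ℕ → V) (k : ℕ) (y w : ι) : Prop :=
  Precedes (o (α k) (α (k + 1))) y w ∧ Overtaken U T o i a q α k y ∧
    ¬ Overtaken U T o i a q α k w ∧ (w = a ∨ Precedes (o (α k) (α (k + 1))) w a)

theorem uses_self (C : OvertakeConfig U T S o i a q s α) (hk : k ≤ q) :
    U a (α k) (α (k + 1)) := C.path.uses_succ (by omega)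

theorem ne_succ_succ (C : OvertakeConfig U T S o i a q s α) (hk : k + 1 ≤ q) :
    α k ≠ α (k + 1 + 1) := fun h => by
  have := C.path.inj (by omega) (by omega) h
  omega

theorem along (C : OvertakeConfig U T S o i a q s α) {o' : V → V → List ι} (ho' : S o')
    {g h : ι} {b c : ℕ} (hbc : b ≤ c) (hc : c ≤ q)
    (hg : ∀ k, b ≤ k → k ≤ c → U g (α k) (α (k + 1)))
    (hh : ∀ k, b ≤ k → k ≤ c → U h (α k) (α (k + 1))) :
    Precedes (o' (α b) (α (b + 1))) g h ↔ Precedes (o' (α c) (α (c + 1))) g h :=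
  C.sys.precedes_along ho' C.path.inj hbc (by omega) hg hh

theorem along_self (C : OvertakeConfig U T S o i a q s α) {o' : V → V → List ι} (ho' : S o')
    {g : ι} {b c : ℕ} (hbc : b ≤ c) (hc : c ≤ q)
    (hg : ∀ k, b ≤ k → k ≤ c → U g (α k) (α (k + 1))) :
    Precedes (o' (α b) (α (b + 1))) g a ↔ Precedes (o' (α c) (α (c + 1))) g a :=
  C.along ho' hbc hc hg fun _ _ h => C.uses_self (h.trans hc)

theorem before_last (C : OvertakeConfig U T S o i a q s α) :
    Precedes (o (α q) (α (q + 1))) i a :=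
  (C.along_self C.adm C.start_le le_rfl C.uses).1 C.before

theorem overtaken_init (C : OvertakeConfig U T S o i a q s α) (hk : s ≤ k) :
    Overtaken U T o i a q α k i :=
  ⟨⟨s, hk, C.start, C.uses⟩, Or.inl rfl, C.before_last⟩

theorem precedes_of_overtaken (C : OvertakeConfig U T S o i a q s α) (hk : k ≤ q)
    (hy : Overtaken U T o i a q α k y) : Precedes (o (α k) (α (k + 1))) y a := by
  obtain ⟨⟨k₀, hk₀, -, hu⟩, -, hya⟩ := hy
  exact (C.along_self C.adm hk le_rfl fun n h₁ h₂ => hu n (by omega) h₂).2 hya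

theorem init_precedes (C : OvertakeConfig U T S o i a q s α) (hs : s ≤ k) (hk : k ≤ q)
    (hy : Overtaken U T o i a q α k y) : y = i ∨ Precedes (o (α k) (α (k + 1))) i y := by
  obtain ⟨⟨k₀, hk₀, -, hu⟩, hiy, -⟩ := hy
  exact hiy.imp_right (C.along C.adm hk le_rfl (fun n h₁ h₂ => C.uses n (by omega) h₂)
    fun n h₁ h₂ => hu n (by omega) h₂).2

/-- A line between `i` and `a` that covers their common part is not forced to stay before `a`. -/
theorem not_always_of_covering (C : OvertakeConfig U T S o i a q s α) {l : ι}
    (hl : ∀ k, s ≤ k → k ≤ q → U l (α k) (α (k + 1))) (ht : ¬ T l (α (q + 1)))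
    (hil : Precedes (o (α q) (α (q + 1))) i l)
    (hla : ∀ o', S o' → Precedes (o' (α q) (α (q + 1))) l a) : False :=
  C.not_separated l q C.start_le le_rfl (C.covering l hl ht hil (hla o C.adm)) hla

/-- A line that starts on `a` and reaches the end of `a` continues beyond it. -/
theorem not_term_end (C : OvertakeConfig U T S o i a q s α) (hya : y ≠ a) (hk₀ : k₀ ≤ q)
    (hT : T y (α k₀)) (hu : ∀ n, k₀ ≤ n → n ≤ q → U y (α n) (α (n + 1))) :
    ¬ T y (α (q + 1)) := by
  intro hT'
  obtain ⟨N, f', hf'⟩ := C.sys.exists_path y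
  obtain ⟨f, hf, hf0⟩ := hf'.exists_start hT
  obtain ⟨hN, hfα⟩ := hf.follow (g := fun n => α (k₀ + n)) (K := q + 1 - k₀)
    (fun {b c} hb hc h => by
      have := C.path.inj (by omega) (by omega) h
      omega)
    (fun n hn => hu (k₀ + n) (by omega) (by omega)) (by simpa using hf0)
  have h₁ := hfα (q + 1 - k₀) le_rfl
  simp only [show k₀ + (q + 1 - k₀) = q + 1 by omega] at h₁
  rw [← h₁] at hT'
  have hNe : q + 1 - k₀ = N := by
    rcases (hf.term _).1 hT' with h | h
    · have := hf.inj hN (Nat.zero_le _) h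
      omega
    · exact hf.inj hN le_rfl h
  refine C.sys.proper (l := a) (l' := y) hya.symm fun x z hxz => ?_
  obtain ⟨n, hn, hn'⟩ := (hf.uses _ _).1 hxz
  rw [hfα n (by omega), hfα (n + 1) (by omega)] at hn'
  exact (C.path.uses _ _).2 ⟨k₀ + n, by omega, hn'⟩

/-- An overtaken line that starts before `i` is not forced to stay before `a`. -/
theorem not_always_of_early_start (C : OvertakeConfig U T S o i a q s α)
    (hy : Overtaken U T o i a q α k y) (hks : k < s) (hk : k ≤ q)
    (hya : ∀ o', S o' → Precedes (o' (α k) (α (k + 1))) y a) : False := by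
  obtain ⟨⟨k₀, hk₀, hT, hu⟩, hiy, hya'⟩ := hy
  have hne : y ≠ i := by
    rintro rfl
    obtain ⟨t, rfl⟩ : ∃ t, s = t + 1 := ⟨s - 1, by omega⟩
    have := C.start_le
    exact C.sys.not_term (C.sys.symm (hu t (by omega) (by omega))) (hu (t + 1) (by omega) this)
      (C.ne_succ_succ this) C.start
  refine C.not_always_of_covering (l := y) (fun n h₁ h₂ => hu n (by omega) h₂)
    (C.not_term_end (hya'.ne (C.sys.nodup C.adm _ _)) (by omega) hT hu) (hiy.resolve_left hne) ?_
  exact fun o' ho' =>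
    (C.along_self ho' hk le_rfl fun n h₁ h₂ => hu n (by omega) h₂).1 (hya o' ho')

theorem not_always_of_early_start' (C : OvertakeConfig U T S o i a q s α)
    (hy : Overtaken U T o i a q α k y) (hk : k ≤ q) (hk₀ : k₀ < s) (hk₀k : k₀ ≤ k)
    (hT : T y (α k₀)) (hu : ∀ n, k₀ ≤ n → n ≤ q → U y (α n) (α (n + 1)))
    (hya : ∀ o', S o' → Precedes (o' (α k) (α (k + 1))) y a) : False :=
  C.not_always_of_early_start (k := k₀) ⟨⟨k₀, le_rfl, hT, hu⟩, hy.2⟩ hk₀ (by omega) fun o' ho' =>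
    (C.along_self ho' hk₀k hk fun n h₁ h₂ => hu n h₁ (by omega)).2 (hya o' ho')

theorem overtaken_succ (hy : Overtaken U T o i a q α k y) : Overtaken U T o i a q α (k + 1) y := by
  obtain ⟨⟨k₀, hk₀, hT⟩, hy⟩ := hy
  exact ⟨⟨k₀, by omega, hT⟩, hy⟩

theorem overtaken_of_succ (hy : Overtaken U T o i a q α (k + 1) y) (ht : ¬ T y (α (k + 1))) :
    Overtaken U T o i a q α k y := by
  obtain ⟨⟨k₀, hk₀, hT⟩, hy⟩ := hy
  have : k₀ ≠ k + 1 := by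
    rintro rfl
    exact ht hT.1
  exact ⟨⟨k₀, by omega, hT⟩, hy⟩

theorem uses_of_overtaken (hk : k ≤ q) (hy : Overtaken U T o i a q α k y) :
    U y (α k) (α (k + 1)) := by
  obtain ⟨⟨k₀, hk₀, -, hu⟩, -⟩ := hy
  exact hu k hk₀ hk

/-- Between two consecutive edges the order of lines that use both does not change. -/
theorem step (C : OvertakeConfig U T S o i a q s α) (hk : k + 1 ≤ q) {g h : ι}
    (hg : U g (α k) (α (k + 1))) (hg' : U g (α (k + 1)) (α (k + 1 + 1)))
    (hh : U h (α k) (α (k + 1))) (hh' : U h (α (k + 1)) (α (k + 1 + 1))) :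
    Precedes (o (α k) (α (k + 1))) g h ↔ Precedes (o (α (k + 1)) (α (k + 1 + 1))) g h := by
  refine C.along C.adm (Nat.le_succ k) hk ?_ ?_ <;>
  · intro n h₁ h₂
    obtain rfl | rfl : n = k ∨ n = k + 1 := by omega
    · assumption
    · assumption

/-- A line that lies between an overtaken line and `a` diverges from them at neither end. -/
theorem flipped_step_iff (C : OvertakeConfig U T S o i a q s α) (hk : k + 1 ≤ q)
    (hy : Overtaken U T o i a q α k y) (ht : ¬ T w (α (k + 1)))
    (hw : U w (α k) (α (k + 1))) (hw' : U w (α (k + 1)) (α (k + 1 + 1))) :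
    Flipped U T o i a q α k y w ↔ Flipped U T o i a q α (k + 1) y w := by
  have hyk := uses_of_overtaken (by omega) hy
  have hyk' := uses_of_overtaken hk (overtaken_succ hy)
  have h₁ : Overtaken U T o i a q α k w ↔ Overtaken U T o i a q α (k + 1) w :=
    ⟨overtaken_succ, fun h => overtaken_of_succ h ht⟩
  have h₂ : Overtaken U T o i a q α (k + 1) y := overtaken_succ hy
  rw [Flipped, Flipped, C.step hk hyk hyk' hw hw', h₁,
    C.step hk hw hw' (C.uses_self (by omega)) (C.uses_self hk)]
  simp [hy, h₂]

theorem init_precedes_of_flipped (C : OvertakeConfig U T S o i a q s α) (hs : s ≤ k) (hk : k ≤ q)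
    (hf : Flipped U T o i a q α k y w) : Precedes (o (α k) (α (k + 1))) i w := by
  rcases C.init_precedes hs hk hf.2.1 with rfl | h
  · exact hf.1
  · exact h.trans (C.sys.nodup C.adm _ _) hf.1

/-- A line between an overtaken line and `a` does not diverge from both at the right end. -/
theorem not_diverge_right (C : OvertakeConfig U T S o i a q s α) (hk : k + 1 ≤ q)
    (hf : Flipped U T o i a q α k y w) (hwa : w ≠ a) (ht : ¬ T w (α (k + 1)))
    (hw : ¬ U w (α (k + 1)) (α (k + 1 + 1))) : False := by
  have hne := (C.ne_succ_succ hk).symm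
  have hkq : k ≤ q := by omega
  have forced_before : ∀ {g : ι}, Precedes (o (α k) (α (k + 1))) g w →
      U g (α (k + 1)) (α (k + 1 + 1)) →
      ∀ o', S o' → Precedes (o' (α k) (α (k + 1))) g w := by
    intro g hg hg' o' ho'
    rw [← C.sys.precedes_rev ho']
    rw [← C.sys.precedes_rev C.adm] at hg
    exact C.sys.always_of_left_diverge C.adm hg hne hg' ht hw ho'
  have forced_after : ∀ o', S o' → Precedes (o' (α k) (α (k + 1))) w a := by
    intro o' ho'
    have hg := hf.2.2.2.resolve_left hwa
    rw [← C.sys.precedes_rev ho']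
    rw [← C.sys.precedes_rev C.adm] at hg
    exact C.sys.always_of_right_diverge C.adm hg hne (C.uses_self hk) ht hw ho'
  rcases Nat.lt_or_ge k s with hs | hs
  · exact C.not_always_of_early_start hf.2.1 hs hkq fun o' ho' =>
      (forced_before hf.1 (uses_of_overtaken hk (overtaken_succ hf.2.1)) o' ho').trans
        (C.sys.nodup ho' _ _) (forced_after o' ho')
  · exact C.not_separated w k hs hkq
      (forced_before (C.init_precedes_of_flipped hs hkq hf) (C.uses _ (by omega) hk)) forced_after

theorem not_diverge_left (C : OvertakeConfig U T S o i a q s α) (hk : k + 1 ≤ q)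
    (hf : Flipped U T o i a q α (k + 1) y w) (hwa : w ≠ a) (hty : ¬ T y (α (k + 1)))
    (ht : ¬ T w (α (k + 1))) (hw : ¬ U w (α k) (α (k + 1))) : False := by
  have hne := C.ne_succ_succ hk
  have hkq : k ≤ q := by omega
  have hy := overtaken_of_succ hf.2.1 hty
  have hw' : ¬ U w (α (k + 1)) (α k) := fun h => hw (C.sys.symm h)
  have forced_before : ∀ {g : ι}, Precedes (o (α (k + 1)) (α (k + 1 + 1))) g w →
      U g (α k) (α (k + 1)) →
      ∀ o', S o' → Precedes (o' (α (k + 1)) (α (k + 1 + 1))) g w := fun hg hg' o' ho' =>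
    C.sys.always_of_right_diverge C.adm hg hne (C.sys.symm hg') ht hw' ho'
  have forced_after : ∀ o', S o' → Precedes (o' (α (k + 1)) (α (k + 1 + 1))) w a :=
    fun o' ho' => C.sys.always_of_left_diverge C.adm (hf.2.2.2.resolve_left hwa) hne
      (C.sys.symm (C.uses_self hkq)) ht hw' ho'
  rcases Nat.lt_or_ge k s with hs | hs
  · obtain ⟨k₀, hk₀, hT, hu⟩ := hy.1
    exact C.not_always_of_early_start' hf.2.1 hk (k₀ := k₀) (by omega) (by omega) hT hu
      fun o' ho' => (forced_before hf.1 (uses_of_overtaken hkq hy) o' ho').trans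
        (C.sys.nodup ho' _ _) (forced_after o' ho')
  · exact C.not_separated w (k + 1) (by omega) hk
      (forced_before (C.init_precedes_of_flipped (by omega) hk hf) (C.uses _ hs hkq)) forced_after

/-- A line between an overtaken line and `a` at the end of `a` has a terminal there. -/
theorem term_of_flipped_end (C : OvertakeConfig U T S o i a q s α)
    (hf : Flipped U T o i a q α q y w) (hwa : w ≠ a) : T w (α (q + 1)) := by
  by_contra ht
  have hiw := C.init_precedes_of_flipped C.start_le le_rfl hf
  have hw_a := hf.2.2.2.resolve_left hwa
  have hwq : U w (α q) (α (q + 1)) := C.sys.left_uses C.adm hw_a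
  classical
  have hex : ∃ b, b ≤ q ∧ ∀ n, b ≤ n → n ≤ q → U w (α n) (α (n + 1)) :=
    ⟨q, le_rfl, fun n h₁ h₂ => by rwa [show n = q by omega]⟩
  obtain ⟨hbq, hbu⟩ := Nat.find_spec hex
  have hbmin := fun c => Nat.find_min hex (m := c)
  set b := Nat.find hex
  have htb : ¬ T w (α b) := fun h => hf.2.2.1 ⟨⟨b, hbq, h, hbu⟩, Or.inr hiw, hw_a⟩
  rcases Nat.eq_zero_or_pos b with hb0 | hb0
  · refine C.sys.proper hwa fun x z hxz => ?_
    obtain ⟨n, hn, ⟨rfl, rfl⟩ | ⟨rfl, rfl⟩⟩ := (C.path.uses _ _).1 hxz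
    · exact hbu n (by omega) (by omega)
    · exact C.sys.symm (hbu n (by omega) (by omega))
  · obtain ⟨c, hc⟩ : ∃ c, b = c + 1 := ⟨b - 1, by omega⟩
    rw [hc] at htb hbq hbu hbmin
    have hwc : ¬ U w (α (c + 1)) (α c) := by
      intro h
      refine hbmin c (by omega) ⟨by omega, fun n h₁ h₂ => ?_⟩
      rcases Nat.eq_or_lt_of_le h₁ with rfl | h₁
      · exact C.sys.symm h
      · exact hbu n h₁ h₂
    have hne := C.ne_succ_succ hbq
    have forced_after : ∀ o', S o' → Precedes (o' (α (c + 1)) (α (c + 1 + 1))) w a :=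
      fun o' ho' => C.sys.always_of_left_diverge C.adm
        ((C.along_self C.adm hbq le_rfl hbu).2 hw_a) hne
        (C.sys.symm (C.uses_self (by omega))) htb hwc ho'
    rcases Nat.lt_or_ge c s with hs | hs
    · exact C.not_always_of_covering (fun n h₁ h₂ => hbu n (by omega) h₂) ht hiw fun o' ho' =>
        (C.along_self ho' hbq le_rfl hbu).1 (forced_after o' ho')
    · refine C.not_separated w (c + 1) (by omega) hbq (fun o' ho' => ?_) forced_after
      exact C.sys.always_of_right_diverge C.adm
        ((C.along C.adm hbq le_rfl (fun n h₁ h₂ => C.uses n (by omega) h₂) hbu).2 hiw) hne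
        (C.sys.symm (C.uses c hs (by omega))) htb hwc ho'

theorem flipped_right (C : OvertakeConfig U T S o i a q s α) (hk : k ≤ q)
    (hf : Flipped U T o i a q α k y w) :
    T w (α (k + 1)) ∨ (k + 1 ≤ q ∧ Flipped U T o i a q α (k + 1) y w) := by
  by_cases ht : T w (α (k + 1))
  · exact Or.inl ht
  rcases Nat.eq_or_lt_of_le hk with rfl | hk'
  · by_cases hwa : w = a
    · exact Or.inl ((hwa ▸ C.path.term _).2 (Or.inr rfl))
    · exact Or.inl (C.term_of_flipped_end hf hwa)
  · refine Or.inr ⟨hk', (C.flipped_step_iff hk' hf.2.1 ht (C.sys.right_uses C.adm hf.1) ?_).1 hf⟩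
    by_contra hw
    by_cases hwa : w = a
    · exact hw (hwa ▸ C.uses_self hk')
    · exact C.not_diverge_right hk' hf hwa ht hw

theorem flipped_left (C : OvertakeConfig U T S o i a q s α) (hk : k ≤ q)
    (hf : Flipped U T o i a q α k y w) :
    T y (α k) ∨ T w (α k) ∨ (∃ n, k = n + 1 ∧ Flipped U T o i a q α n y w) := by
  by_cases hty : T y (α k)
  · exact Or.inl hty
  by_cases ht : T w (α k)
  · exact Or.inr (Or.inl ht)
  refine Or.inr (Or.inr ?_)
  obtain ⟨k₀, hk₀, hT, -⟩ := hf.2.1.1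
  have hne : k₀ ≠ k := by
    rintro rfl
    exact hty hT
  obtain ⟨n, rfl⟩ : ∃ n, k = n + 1 := ⟨k - 1, by omega⟩
  refine ⟨n, rfl, (C.flipped_step_iff hk (overtaken_of_succ hf.2.1 hty) ht ?_
    (C.sys.right_uses C.adm hf.1)).2 hf⟩
  by_contra hw
  by_cases hwa : w = a
  · exact hw (hwa ▸ C.uses_self (by omega))
  · exact C.not_diverge_left hk hf hwa hty ht hw

end OvertakeConfig

namespace OvertakeConfig

variable {V ι : Type} {U : ι → V → V → Prop} {T : ι → V → Prop} {S : (V → V → List ι) → Prop}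
  {o : V → V → List ι} {i a : ι} {q s : ℕ} {α : ℕ → V} {k : ℕ} {y w : ι}

/-- The order in which `a` overtakes on every one of its edges. -/
theorem exists_order (C : OvertakeConfig U T S o i a q s α) :
    ∃ o' : V → V → List ι,
      (∀ k ≤ q, o' (α k) (α (k + 1)) =
        moveBehind a (Overtaken U T o i a q α k) (o (α k) (α (k + 1)))) ∧
      (∀ x y, o' y x = (o' x y).reverse) ∧ ∀ x y, ¬ U a x y → o' x y = o x y := by
  classical
  let r : V → V → ℕ → Prop := fun x y k => k ≤ q ∧ x = α k ∧ y = α (k + 1)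
  let m : V → V → ℕ → List ι := fun x y k => moveBehind a (Overtaken U T o i a q α k) (o x y)
  have r_unique : ∀ {x y k l}, r x y k → r x y l → k = l := by
    rintro x y k l ⟨hk, hx, -⟩ ⟨hl, hx', -⟩
    exact C.path.inj (by omega) (by omega) (hx.symm.trans hx')
  have r_asymm : ∀ {x y k l}, r x y k → ¬ r y x l := by
    rintro x y k l ⟨hk, hx, hy⟩ ⟨hl, hy', hx'⟩
    have h₁ := C.path.inj (by omega) (by omega) (hx.symm.trans hx')
    have h₂ := C.path.inj (by omega) (by omega) (hy.symm.trans hy')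
    omega
  let o' : V → V → List ι := fun x y =>
    if h : ∃ k, r x y k then m x y h.choose
    else if h : ∃ k, r y x k then (m y x h.choose).reverse else o x y
  have o'_of_r : ∀ {x y k}, r x y k → o' x y = m x y k := by
    intro x y k hr
    have h : ∃ k, r x y k := ⟨k, hr⟩
    simp only [o', dif_pos h]
    rw [r_unique h.choose_spec hr]
  have o'_of_r_rev : ∀ {x y k}, r x y k → o' y x = (m x y k).reverse := by
    intro x y k hr
    have h : ∃ k, r x y k := ⟨k, hr⟩
    have h' : ¬ ∃ k, r y x k := fun ⟨l, hl⟩ => r_asymm hr hl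
    simp only [o', dif_pos h, dif_neg h']
    rw [r_unique h.choose_spec hr]
  have o'_of_not : ∀ {x y}, (¬ ∃ k, r x y k) → (¬ ∃ k, r y x k) → o' x y = o x y := by
    intro x y h h'
    simp only [o', dif_neg h, dif_neg h']
  refine ⟨o', fun k hk => o'_of_r ⟨hk, rfl, rfl⟩, fun x y => ?_, fun x y hxy => ?_⟩
  · by_cases h : ∃ k, r x y k
    · obtain ⟨k, hk⟩ := h
      rw [o'_of_r hk, o'_of_r_rev hk]
    · by_cases h' : ∃ k, r y x k
      · obtain ⟨k, hk⟩ := h'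
        rw [o'_of_r hk, o'_of_r_rev hk, List.reverse_reverse]
      · rw [o'_of_not h h', o'_of_not h' h, C.sys.rev C.adm]
  · refine o'_of_not ?_ ?_
    · rintro ⟨k, hk, rfl, rfl⟩
      exact hxy (C.uses_self hk)
    · rintro ⟨k, hk, rfl, rfl⟩
      exact hxy (C.sys.symm (C.uses_self hk))

/-- If nothing forces `i` to stay before `a`, then `a` can be moved directly in front of `i`. -/
theorem exists_overtaken (C : OvertakeConfig U T S o i a q s α) :
    ∃ o', S o' ∧ (∀ k, s ≤ k → k ≤ q → [a, i] <:+: o' (α k) (α (k + 1))) ∧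
      ∀ g h, Precedes (o (α s) (α (s + 1))) g h → Precedes (o' (α s) (α (s + 1))) h g →
        (g = i ∨ Precedes (o (α s) (α (s + 1))) i g) ∧ Precedes (o (α s) (α (s + 1))) g a ∧
          (h = a ∨ Precedes (o (α s) (α (s + 1))) h a) := by
  obtain ⟨o', h_fwd, h_rev, h_eq⟩ := C.exists_order
  have nodup := fun x y => C.sys.nodup C.adm x y
  have mem_self : ∀ {k}, k ≤ q → a ∈ o (α k) (α (k + 1)) := fun hk =>
    (C.sys.mem C.adm _ _ _).2 (C.uses_self hk)
  have flip_iff : ∀ {k g h}, k ≤ q → ((Precedes (o (α k) (α (k + 1))) g h ∧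
      Precedes (o' (α k) (α (k + 1))) h g) ↔ Flipped U T o i a q α k g h) := by
    intro k g h hk
    rw [h_fwd k hk]
    exact moveBehind_flip_iff (nodup _ _) (mem_self hk)
  refine ⟨o', C.sys.modify C.adm ?_ h_rev ?_, fun k hs hk => ?_, fun g h h₁ h₂ => ?_⟩
  · intro x y
    by_cases hxy : U a x y
    · obtain ⟨k, hk, ⟨rfl, rfl⟩ | ⟨rfl, rfl⟩⟩ := (C.path.uses _ _).1 hxy
      · rw [h_fwd k (by omega)]
        exact moveBehind_perm
      · rw [h_rev (α k), h_fwd k (by omega), C.sys.rev C.adm (α k)]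
        exact (List.reverse_perm _).trans (moveBehind_perm.trans (List.reverse_perm _).symm)
    · rw [h_eq x y hxy]
  · intro x c g h h₁ h₂
    by_cases hxy : U a x c
    · obtain ⟨k, hk, ⟨rfl, rfl⟩ | ⟨rfl, rfl⟩⟩ := (C.path.uses _ _).1 hxy
      · rcases C.flipped_left (by omega) ((flip_iff (by omega)).1 ⟨h₁, h₂⟩) with
          h | h | ⟨n, rfl, hf⟩
        · exact Or.inl h
        · exact Or.inr (Or.inl h)
        · refine Or.inr (Or.inr ⟨α n, C.ne_succ_succ (by omega), ?_⟩)
          rw [h_rev (α n), C.sys.precedes_rev C.adm, Precedes.reverse_iff]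
          exact (flip_iff (by omega)).2 hf
      · rw [C.sys.precedes_rev C.adm] at h₁
        rw [h_rev (α k), Precedes.reverse_iff] at h₂
        rcases C.flipped_right (by omega) ((flip_iff (by omega)).1 ⟨h₁, h₂⟩) with h | ⟨hk', hf⟩
        · exact Or.inl h
        · exact Or.inr (Or.inr ⟨_, (C.ne_succ_succ hk').symm, (flip_iff hk').2 hf⟩)
    · rw [h_eq x c hxy] at h₂
      exact (h₁.asymm (nodup _ _) h₂).elim
  · rw [h_fwd k hk]
    refine moveBehind_infix (nodup _ _) (mem_self hk) (fun x => C.precedes_of_overtaken hk)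
      (C.overtaken_init hs) ((C.sys.mem C.adm _ _ _).2 (C.uses k hs hk)) ?_
    exact fun x _ hx hne => (C.init_precedes hs hk hx).resolve_left hne
  · have hf := (flip_iff C.start_le).1 ⟨h₁, h₂⟩
    exact ⟨C.init_precedes le_rfl C.start_le hf.2.1, C.precedes_of_overtaken C.start_le hf.2.1,
      hf.2.2.2⟩

end OvertakeConfig

namespace LineSystem

variable {V ι : Type} {U : ι → V → V → Prop} {T : ι → V → Prop} {S : (V → V → List ι) → Prop}
  {o : V → V → List ι} {i j l : ι} {β : ℕ → V} {N n r : ℕ}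

/-- Line `l` ends at `β r` after following `β` from `β 0`, it is `j` or before `j`, and, unless it
is `j`, it is not forced to be behind `i`. -/
def Candidate (U : ι → V → V → Prop) (T : ι → V → Prop) (S : (V → V → List ι) → Prop)
    (o : V → V → List ι) (i j : ι) (β : ℕ → V) (r : ℕ) (l : ι) : Prop :=
  T l (β r) ∧ (∀ k < r, U l (β k) (β (k + 1))) ∧ Precedes (o (β 0) (β 1)) i l ∧
    (l = j ∨ (Precedes (o (β 0) (β 1)) l j ∧ ¬ ∀ o', S o' → Precedes (o' (β 0) (β 1)) i l))

theorem precedes_first (H : LineSystem U T S) (hβ : LinePath (U i) (T i) N β) (ho : S o)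
    {g h : ι} {k : ℕ} (hk : k < N) (hg : ∀ n ≤ k, U g (β n) (β (n + 1)))
    (hh : ∀ n ≤ k, U h (β n) (β (n + 1))) :
    Precedes (o (β 0) (β 1)) g h ↔ Precedes (o (β k) (β (k + 1))) g h :=
  H.precedes_along ho hβ.inj (Nat.zero_le k) hk (fun n _ hn => hg n hn) fun n _ hn => hh n hn

/-- A line that follows `β`, has no terminal at the end of the last candidate and may be placed
between `i` and that candidate, is forced to be behind `i`. -/
theorem always_of_covering (H : LineSystem U T S) (hβ : LinePath (U i) (T i) N β) (ho : S o)
    {a : ι} (hrN : r < N) (ha : Candidate U T S o i j β (r + 1) a)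
    (hmax : ∀ r' ≤ N, r + 1 < r' → ∀ l, ¬ Candidate U T S o i j β r' l)
    (hl : ∀ k < r + 1, U l (β k) (β (k + 1))) (ht : ¬ T l (β (r + 1)))
    (hil : Precedes (o (β r) (β (r + 1))) i l) (hla : Precedes (o (β r) (β (r + 1))) l a) :
    ∀ o', S o' → Precedes (o' (β r) (β (r + 1))) i l := by
  classical
  intro o' ho'
  have hne : i ≠ l := hil.ne (H.nodup ho _ _)
  have hi : ∀ k < N, U i (β k) (β (k + 1)) := fun k hk => hβ.uses_succ hk
  refine (H.total ho' (hi r hrN) (hl r (by omega)) hne).resolve_right fun hli => ?_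
  let Q : ℕ → Prop := fun r' => ∀ k < r', U l (β k) (β (k + 1))
  have hQ : Q (Nat.findGreatest Q N) := Nat.findGreatest_spec (P := Q) (m := r + 1) hrN hl
  have hle : r + 1 ≤ Nat.findGreatest Q N := Nat.le_findGreatest hrN hl
  have hN : Nat.findGreatest Q N ≤ N := Nat.findGreatest_le N
  have hgt : ∀ k, Nat.findGreatest Q N < k → k ≤ N → ¬ Q k := fun k h₁ h₂ =>
    Nat.findGreatest_is_greatest h₁ h₂
  obtain ⟨t, ht'⟩ : ∃ t, Nat.findGreatest Q N = t + 1 :=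
    ⟨Nat.findGreatest Q N - 1, by omega⟩
  rw [ht'] at hQ hle hN hgt
  have h0 : Precedes (o (β 0) (β 1)) i l :=
    (H.precedes_first hβ ho hrN (fun n hn => hi n (by omega)) fun n hn => hl n (by omega)).2 hil
  have h0' : Precedes (o' (β 0) (β 1)) l i :=
    (H.precedes_first hβ ho' hrN (fun n hn => hl n (by omega)) fun n hn => hi n (by omega)).2 hli
  have h_t := (H.precedes_first hβ ho (k := t) (by omega) (fun n hn => hi n (by omega))
    fun n hn => hQ n (by omega)).1 h0
  have h_t' := (H.precedes_first hβ ho' (k := t) (by omega) (fun n hn => hQ n (by omega))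
    fun n hn => hi n (by omega)).1 h0'
  rw [← H.precedes_rev ho] at h_t
  rw [← H.precedes_rev ho'] at h_t'
  rcases H.split ho ho' h_t h_t' with h | h | ⟨d, hd, hd₁, hd₂⟩
  · have hrt : t ≠ r := by
      rintro rfl
      exact ht h
    refine hmax (t + 1) hN (by omega) l ⟨h, hQ, h0, Or.inr ⟨?_, fun hall => ?_⟩⟩
    · have hla0 : Precedes (o (β 0) (β 1)) l a := (H.precedes_first hβ ho hrN
        (fun n hn => hl n (by omega)) fun n hn => ha.2.1 n (by omega)).2 hla
      rcases ha.2.2.2 with rfl | h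
      exacts [hla0, hla0.trans (H.nodup ho _ _) h.1]
    · exact (hall o' ho').asymm (H.nodup ho' _ _) h0'
  · have hNt : t + 1 = N := by
      rcases (hβ.term _).1 h with h | h
      · have := hβ.inj hN (Nat.zero_le _) h
        omega
      · exact hβ.inj hN le_rfl h
    refine H.proper (l := l) (l' := i) hne.symm fun x y hxy => ?_
    obtain ⟨k, hk, ⟨rfl, rfl⟩ | ⟨rfl, rfl⟩⟩ := (hβ.uses _ _).1 hxy
    · exact hQ k (by omega)
    · exact H.symm (hQ k (by omega))
  · rcases hβ.uses_left hN hd₂ with ⟨h₁, rfl⟩ | ⟨h₁, rfl⟩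
    · refine hgt (t + 1 + 1) (by omega) (by omega) fun k hk => ?_
      rcases Nat.lt_or_ge k (t + 1) with hk' | hk'
      · exact hQ k hk'
      · rwa [show k = t + 1 by omega]
    · simp at hd

/-- Some line between `i` and `j` can overtake all lines in front of it back to `i`. -/
theorem exists_overtakeConfig (H : LineSystem U T S) (hβ : LinePath (U i) (T i) N β) (ho : S o)
    (hn : 1 ≤ n) (hnN : n ≤ N) (hTj : T j (β n)) (hUj : ∀ k < n, U j (β k) (β (k + 1)))
    (hij : Precedes (o (β 0) (β 1)) i j)
    (hnosep : ∀ l, ∀ k < n, (∀ o, S o → Precedes (o (β k) (β (k + 1))) i l) →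
      (∀ o, S o → Precedes (o (β k) (β (k + 1))) l j) → False) :
    ∃ a q s α, OvertakeConfig U T S o i a q s α ∧ n ≤ q + 1 - s ∧
      (∀ k ≤ q + 1 - s, α (s + k) = β k) ∧ (a = j ∨ Precedes (o (β 0) (β 1)) a j) := by
  classical
  let Q : ℕ → Prop := fun r => ∃ l, Candidate U T S o i j β r l
  have hQn : Q n := ⟨j, hTj, hUj, hij, Or.inl rfl⟩
  obtain ⟨a, ha⟩ : Q (Nat.findGreatest Q N) := Nat.findGreatest_spec hnN hQn
  have hnr : n ≤ Nat.findGreatest Q N := Nat.le_findGreatest hnN hQn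
  have hrN : Nat.findGreatest Q N ≤ N := Nat.findGreatest_le N
  have hmax : ∀ r' ≤ N, Nat.findGreatest Q N < r' → ∀ l, ¬ Candidate U T S o i j β r' l :=
    fun r' h₁ h₂ l hl => Nat.findGreatest_is_greatest h₂ h₁ ⟨l, hl⟩
  obtain ⟨r, hr⟩ : ∃ r, Nat.findGreatest Q N = r + 1 :=
    ⟨Nat.findGreatest Q N - 1, by omega⟩
  rw [hr] at ha hnr hrN hmax
  have hi : ∀ k < N, U i (β k) (β (k + 1)) := fun k hk => hβ.uses_succ hk
  obtain ⟨m, f', hf'⟩ := H.exists_path a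
  obtain ⟨f, hf, hf0⟩ := hf'.exists_start ha.1
  obtain ⟨hrm, hfβ⟩ := hf.follow (g := fun t => β (r + 1 - t)) (K := r + 1)
    (fun {b c} hb hc h => by
      have := hβ.inj (by omega) (by omega) h
      omega)
    (fun k hk => by
      have := H.symm (ha.2.1 (r - k) (by omega))
      rwa [show r - k + 1 = r + 1 - k by omega, show r - k = r + 1 - (k + 1) by omega] at this)
    (by simpa using hf0)
  obtain ⟨s, rfl⟩ : ∃ s, m = s + r + 1 := ⟨m - (r + 1), by omega⟩
  have hα : ∀ k ≤ r + 1, f (s + r + 1 - (s + k)) = β k := by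
    intro k hk
    rw [hfβ _ (by omega)]
    congr 1
    omega
  refine ⟨a, s + r, s, fun k => f (s + r + 1 - k), ?_, by omega, fun k hk => hα k (by omega),
    ha.2.2.2.imp_right And.left⟩
  have exists_index : ∀ {k}, s ≤ k → k ≤ s + r → ∃ t ≤ r, k = s + t := fun {k} h₁ h₂ =>
    ⟨k - s, by omega, by omega⟩
  have hα' : ∀ t ≤ r, f (s + r + 1 - (s + t + 1)) = β (t + 1) := fun t ht => hα (t + 1) (by omega)
  refine
    { sys := H
      adm := ho
      path := hf.reverse
      start_le := by omega
      start := ?_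
      uses := ?_
      before := ?_
      not_separated := ?_
      covering := ?_ }
  · have := hα 0 (by omega)
    rw [add_zero] at this
    rw [this]
    exact (hβ.term _).2 (Or.inl rfl)
  · intro k h₁ h₂
    obtain ⟨t, ht, rfl⟩ := exists_index h₁ h₂
    simp only [hα t (by omega), hα' t ht]
    exact hi t (by omega)
  · have h₁ := hα 0 (by omega)
    have h₂ := hα 1 (by omega)
    rw [add_zero] at h₁
    rw [h₁, h₂]
    exact ha.2.2.1
  · intro l k h₁ h₂ hil hla
    obtain ⟨t, ht, rfl⟩ := exists_index h₁ h₂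
    simp only [hα t (by omega), hα' t ht] at hil hla
    rcases ha.2.2.2 with rfl | h
    · refine hnosep l t ?_ hil hla
      by_contra htn
      obtain ⟨p, rfl⟩ : ∃ p, n = p + 1 := ⟨n - 1, by omega⟩
      refine H.not_term (H.symm (ha.2.1 p (by omega))) (ha.2.1 (p + 1) (by omega)) ?_ hTj
      intro h
      have := hβ.inj (by omega) (by omega) h
      omega
    · refine h.2 fun o' ho' => ?_
      rw [H.precedes_first hβ ho' (k := t) (by omega) (fun n hn => hi n (by omega))
        fun n hn => ha.2.1 n (by omega)]
      exact (hil o' ho').trans (H.nodup ho' _ _) (hla o' ho')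
  · intro l hl ht hil hla
    simp only [hα r (by omega), hα' r le_rfl] at ht hil hla ⊢
    refine H.always_of_covering hβ ho (by omega) ha hmax (fun t ht => ?_) ht hil hla
    have := hl (s + t) (by omega) (by omega)
    rwa [hα t (by omega), hα' t (by omega)] at this

/-- If no line is forced to lie between `i` and `j`, then these lines can be made adjacent. -/
theorem exists_adjacent [Finite ι] (H : LineSystem U T S) (hβ : LinePath (U i) (T i) N β)
    (ho : S o) (hn : 1 ≤ n) (hnN : n ≤ N) (hTj : T j (β n))
    (hUj : ∀ k < n, U j (β k) (β (k + 1))) (hij : Precedes (o (β 0) (β 1)) i j)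
    (hnosep : ∀ l, ∀ k < n, (∀ o, S o → Precedes (o (β k) (β (k + 1))) i l) →
      (∀ o, S o → Precedes (o (β k) (β (k + 1))) l j) → False) :
    ∃ o', S o' ∧ ∀ k < n, [j, i] <:+: o' (β k) (β (k + 1)) := by
  induction hB : {l | Precedes (o (β 0) (β 1)) i l ∧ Precedes (o (β 0) (β 1)) l j}.ncard
    using Nat.strong_induction_on generalizing o with
  | _ B ih =>
  obtain ⟨a, q, s, α, C, hnq, hα, haj⟩ :=
    H.exists_overtakeConfig hβ ho hn hnN hTj hUj hij hnosep
  obtain ⟨o', ho', hadj, hflip⟩ := C.exists_overtaken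
  rcases haj with rfl | haj
  · refine ⟨o', ho', fun k hk => ?_⟩
    have := hadj (s + k) (by omega) (by omega)
    rwa [hα k (by omega), add_assoc, hα (k + 1) (by omega)] at this
  · have hαs := hα 0 (by omega)
    have hαs' := hα 1 (by omega)
    rw [add_zero] at hαs
    have hai : Precedes (o' (β 0) (β 1)) a i := by
      have := hadj s le_rfl C.start_le
      rw [hαs, hαs'] at this
      exact this.sublist
    have hia := C.before
    rw [hαs, hαs'] at hflip hia
    have nodup := H.nodup ho (β 0) (β 1)
    have nodup' := H.nodup ho' (β 0) (β 1)
    have uses {g h : ι} (hgh : Precedes (o' (β 0) (β 1)) g h) :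
        Precedes (o (β 0) (β 1)) g h ∨ Precedes (o (β 0) (β 1)) h g :=
      H.total ho (H.left_uses ho' hgh) (H.right_uses ho' hgh) (hgh.ne nodup')
    have hij' : Precedes (o' (β 0) (β 1)) i j := by
      rcases H.total ho' (H.left_uses ho hij) (H.right_uses ho hij) (hij.ne nodup) with h | h
      · exact h
      · rcases (hflip i j hij h).2.2 with rfl | h'
        exacts [(haj.ne nodup rfl).elim, (haj.asymm nodup h').elim]
    refine ih _ ?_ ho' hij' rfl
    rw [← hB]
    refine Set.ncard_lt_ncard ?_ (Set.toFinite _)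
    refine ⟨fun l ⟨h₁, h₂⟩ => ⟨?_, ?_⟩, fun h => ?_⟩
    · refine (uses h₁).resolve_right fun h => ?_
      rcases (hflip l i h h₁).1 with rfl | h'
      exacts [h.ne nodup rfl, h.asymm nodup h']
    · refine (uses h₂).resolve_right fun h => ?_
      exact haj.asymm nodup (hflip j l h h₂).2.1
    · exact (h ⟨hia, haj⟩).1.asymm nodup' hai

end LineSystem

/-- Reading all orders in the opposite direction yields a line system. -/
theorem LineSystem.swap {V ι : Type} {U : ι → V → V → Prop} {T : ι → V → Prop}
    {S : (V → V → List ι) → Prop} (H : LineSystem U T S) :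
    LineSystem U T fun o => S fun x y => o y x where
  exists_path := H.exists_path
  proper := H.proper
  mem := fun ho x y l => (H.mem ho y x l).trans ⟨H.symm, H.symm⟩
  nodup := fun ho x y => H.nodup ho y x
  rev := fun ho x y => H.rev ho y x
  pass := by
    intro o ho x c d g h hgc hhc hgd hhd hcd hgh
    have h₁ := H.precedes_rev ho (x := x) (y := c) (g := h) (h := g)
    have h₂ := H.precedes_rev ho (x := d) (y := x) (g := h) (h := g)
    exact h₂.1 (H.pass ho hhc hgc hhd hgd hcd (h₁.2 hgh))
  split := by
    intro o o' ho ho' x c g h h₁ h₂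
    have h₁' := (H.precedes_rev ho (x := x) (y := c)).1 h₁
    have h₂' := (H.precedes_rev ho' (x := x) (y := c)).1 h₂
    rcases H.split ho ho' h₁' h₂' with h | h | ⟨d, hd, hd₁, hd₂⟩
    exacts [Or.inr (Or.inl h), Or.inl h, Or.inr (Or.inr ⟨d, hd, hd₂, hd₁⟩)]
  modify := by
    intro o o' ho hperm hrev hflip
    have hrev' {x y g h} : Precedes (o' x y) g h ↔ Precedes (o' y x) h g := by
      rw [hrev x y, Precedes.reverse_iff]
    refine H.modify ho (fun x y => hperm y x) (fun x y => hrev y x) ?_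
    intro x c g h h₁ h₂
    have h₁' := (H.precedes_rev ho (x := x) (y := c)).2 h₁
    rcases hflip x c h g h₁' (hrev'.1 h₂) with h | h | ⟨d, hd, hd₁, hd₂⟩
    · exact Or.inr (Or.inl h)
    · exact Or.inl h
    · exact Or.inr (Or.inr ⟨d, hd, (H.precedes_rev ho (x := x) (y := d)).1 hd₁, hrev'.1 hd₂⟩)

theorem List.pair_infix_iff {V : Type} {p : List V} {f : ℕ → V}
    (hf : ∀ k < p.length, p[k]? = some (f k)) {x y : V} :
    [x, y] <:+: p ↔ ∃ k, k + 1 < p.length ∧ x = f k ∧ y = f (k + 1) := by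
  rw [List.infix_iff_getElem?]
  constructor
  · rintro ⟨k, hk, h⟩
    have h0 := h 0 (by simp)
    have h1 := h 1 (by simp)
    simp only [List.length_cons, List.length_nil] at hk
    rw [hf _ (by omega)] at h0 h1
    simp only [zero_add, List.getElem_cons_zero, List.getElem_cons_succ, Option.some.injEq,
      Nat.add_comm 1 k] at h0 h1
    exact ⟨k, by omega, h0.symm, h1.symm⟩
  · rintro ⟨k, hk, rfl, rfl⟩
    refine ⟨k, by simp; omega, fun i hi => ?_⟩
    obtain rfl | rfl : i = 0 ∨ i = 1 := by simp at hi; omega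
    · simpa using hf k (by omega)
    · simpa [Nat.add_comm] using hf (k + 1) hk

theorem List.exists_linePath {V : Type} (p : List V) (hp : p.Nodup) (h2 : 2 ≤ p.length) :
    ∃ f : ℕ → V, (∀ k < p.length, p[k]? = some (f k)) ∧
      LinePath (fun x y => [x, y] <:+: p ∨ [y, x] <:+: p)
        (fun x => p.head? = some x ∨ p.getLast? = some x) (p.length - 1) f := by
  obtain ⟨f, hf⟩ : ∃ f : ℕ → V, ∀ k < p.length, p[k]? = some (f k) :=
    ⟨fun k => p.getD k (p[0]'(by omega)), fun k hk => by simp [List.getD, hk]⟩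
  refine ⟨f, hf, fun {a b} ha hb hab => ?_, fun x y => ?_, fun x => ?_⟩
  · have h := (hf a (by omega)).trans ((congrArg some hab).trans (hf b (by omega)).symm)
    exact (List.getElem?_inj (by omega) hp).1 h
  · rw [List.pair_infix_iff hf, List.pair_infix_iff hf]
    constructor
    · rintro (⟨k, hk, h⟩ | ⟨k, hk, h⟩)
      exacts [⟨k, by omega, Or.inl h⟩, ⟨k, by omega, Or.inr h.symm⟩]
    · rintro ⟨k, hk, h | h⟩
      exacts [Or.inl ⟨k, by omega, h⟩, Or.inr ⟨k, by omega, h.symm⟩]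
  · rw [List.head?_eq_getElem?, List.getLast?_eq_getElem?, hf _ (by omega), hf _ (by omega)]
    simp [eq_comm]

theorem List.infix_of_shift {V : Type} {p p' : List V} {f f' : ℕ → V} {c : ℕ}
    (hf : ∀ k < p.length, p[k]? = some (f k)) (hf' : ∀ k < p'.length, p'[k]? = some (f' k))
    (hc : c + p'.length ≤ p.length) (h : ∀ k < p'.length, f (c + k) = f' k) : p' <:+: p := by
  rw [List.infix_iff_getElem?]
  refine ⟨c, by omega, fun k hk => ?_⟩
  rw [hf _ (by omega), Nat.add_comm, h k hk, ← hf' k hk, List.getElem?_eq_getElem hk]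

theorem List.shift_of_infix {V : Type} {p p' : List V} {f : ℕ → V}
    (hf : ∀ k < p.length, p[k]? = some (f k)) (h : p' <:+: p) :
    ∃ c, c + p'.length ≤ p.length ∧ ∀ k < p'.length, p'[k]? = some (f (c + k)) := by
  obtain ⟨c, hc, h⟩ := List.infix_iff_getElem?.1 h
  refine ⟨c, by omega, fun k hk => ?_⟩
  rw [Nat.add_comm c k, ← hf _ (by omega), h k hk, List.getElem?_eq_getElem hk]

namespace MLCMInstance

variable {V ι : Type} {M : MLCMInstance V ι}

theorem exists_linePath {l : ι} {p : List V} (hp : p = M.line l ∨ p = (M.line l).reverse) :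
    ∃ f : ℕ → V, (∀ k < p.length, p[k]? = some (f k)) ∧
      LinePath (M.usesEdge l) (M.Terminal l) (p.length - 1) f := by
  obtain ⟨hnodup, h2, -⟩ := M.line_path l
  rcases hp with rfl | rfl
  · exact (M.line l).exists_linePath hnodup h2
  · obtain ⟨f, hf, h⟩ := (M.line l).reverse.exists_linePath (by simpa using hnodup) (by simpa)
    have rev_infix : ∀ x y, [x, y] <:+: (M.line l).reverse ↔ [y, x] <:+: M.line l := fun x y => by
      simpa using List.reverse_infix (l₁ := [y, x]) (l₂ := M.line l)
    have hU : M.usesEdge l = fun x y =>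
        [x, y] <:+: (M.line l).reverse ∨ [y, x] <:+: (M.line l).reverse := by
      funext x y
      rw [rev_infix, rev_infix, usesEdge, or_comm]
    have hT : M.Terminal l = fun x =>
        (M.line l).reverse.head? = some x ∨ (M.line l).reverse.getLast? = some x := by
      funext x
      rw [List.head?_reverse, List.getLast?_reverse, Terminal, or_comm]
    exact ⟨f, hf, hU ▸ hT ▸ h⟩

theorem usesEdge_symm {l : ι} {x y : V} (h : M.usesEdge l x y) : M.usesEdge l y x := h.symm

/-- A line that uses all edges of another line contains it as a subpath. -/
theorem ProperLines.not_forall_usesEdge (hM : M.ProperLines) {l l' : ι} (hne : l ≠ l') :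
    ¬ ∀ x y, M.usesEdge l' x y → M.usesEdge l x y := by
  intro h
  obtain ⟨f', hf', hp'⟩ := exists_linePath (M := M) (l := l') (Or.inl rfl)
  have hlen' := (M.line_path l').2.1
  have hlen := (M.line_path l).2.1
  have hu : ∀ k < (M.line l').length - 1, M.usesEdge l (f' k) (f' (k + 1)) := fun k hk =>
    h _ _ (hp'.uses_succ hk)
  have key : ∀ p, p = M.line l ∨ p = (M.line l).reverse → ∀ f : ℕ → V,
      (∀ k < p.length, p[k]? = some (f k)) →
      LinePath (M.usesEdge l) (M.Terminal l) (p.length - 1) f →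
      ∀ c < p.length - 1, f' 0 = f c → f' 1 = f (c + 1) → M.line l' <:+: p := by
    intro p hp f hf hlp c hc h0 h1
    obtain ⟨hcN, hfg⟩ := hlp.follow_from hp'.inj hu (by omega) hc h0.symm h1.symm
    have : p.length = (M.line l).length := by rcases hp with rfl | rfl <;> simp
    exact List.infix_of_shift hf hf' (by omega) fun k hk => hfg k (by omega)
  have h0 : ∃ p, (p = M.line l ∨ p = (M.line l).reverse) ∧ M.line l' <:+: p := by
    obtain ⟨f, hf, hlp⟩ := exists_linePath (M := M) (l := l) (Or.inl rfl)
    obtain ⟨g, hg, hlp'⟩ := exists_linePath (M := M) (l := l) (Or.inr rfl)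
    obtain ⟨k, hk, ⟨h0, h1⟩ | ⟨h0, h1⟩⟩ := (hlp.uses _ _).1 (hu 0 (by omega))
    · exact ⟨_, Or.inl rfl, key _ (Or.inl rfl) f hf hlp k hk h0 h1⟩
    · have hfg : ∀ k < (M.line l).length, f k = g ((M.line l).length - 1 - k) := by
        intro k hk
        have h₁ := hg ((M.line l).length - 1 - k) (by simp; omega)
        rw [List.getElem?_reverse (by omega),
          show (M.line l).length - 1 - ((M.line l).length - 1 - k) = k by omega, hf k hk] at h₁
        exact Option.some_injective _ h₁
      refine ⟨_, Or.inr rfl, key _ (Or.inr rfl) g hg hlp' ((M.line l).length - 1 - (k + 1))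
        (by simp; omega) (h0.trans (hfg _ (by omega))) ?_⟩
      rw [show (M.line l).length - 1 - (k + 1) + 1 = (M.line l).length - 1 - k by omega]
      exact h1.trans (hfg _ (by omega))
  obtain ⟨p, rfl | rfl, hp⟩ := h0
  · exact hM l' l hne.symm (Or.inl hp)
  · exact hM l' l hne.symm (Or.inr (by simpa using List.reverse_infix.2 hp))

end MLCMInstance

namespace Precedes

variable {ι : Type} {L K : List ι} {g h : ι}

theorem ext (hL : L.Nodup) (hK : K.Nodup) (hmem : ∀ g, g ∈ L ↔ g ∈ K)
    (hLK : ∀ g h, Precedes L g h → Precedes K g h) : L = K := by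
  refine List.Perm.eq_of_pairwise (le := Precedes K) ?_ ?_ ?_ 
    ((List.perm_ext_iff_of_nodup hL hK).2 hmem)
  · intro a b _ _ h₁ h₂
    exact (h₁.asymm hK h₂).elim
  · exact List.pairwise_iff_forall_sublist.2 fun h => hLK _ _ h
  · exact List.pairwise_iff_forall_sublist.2 fun h => h

theorem filter_pair [DecidableEq ι] (hL : L.Nodup) (hgh : Precedes L g h) :
    L.filter (fun x => x = g ∨ x = h) = [g, h] := by
  have hne := hgh.ne hL
  refine (ext (by simpa using hne) (hL.filter _) ?_ ?_).symm
  · intro x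
    have := hgh.left_mem
    have := hgh.right_mem
    simp only [List.mem_cons, List.not_mem_nil, or_false, List.mem_filter, decide_eq_true_eq]
    grind
  · intro a b hab
    have : a = g ∧ b = h := by simpa [cons_iff, not_nil] using hab
    obtain ⟨rfl, rfl⟩ := this
    simpa [filter_iff] using hgh

end Precedes

/-- The elements `g` and `h` alternate in the cyclic list `L`. -/
def Alternate {ι : Type} (L : List ι) (g h : ι) : Prop :=
  ∃ n, List.Sublist [g, h, g, h] (L.rotate n)

namespace Alternate

variable {V ι : Type} {L K : List ι} {g h : ι}

theorem of_isRotated (hLK : K ~r L) (hK : List.Sublist [g, h, g, h] K) : Alternate L g h := by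
  obtain ⟨n, rfl⟩ := hLK.symm
  exact ⟨n, hK⟩

theorem filter_iff {p : ι → Bool} (hg : p g) (hh : p h) :
    Alternate (L.filter p) g h ↔ Alternate L g h := by
  constructor
  · rintro ⟨n, hn⟩
    rw [List.rotate_eq_drop_append_take_mod] at hn
    obtain ⟨A, B, rfl, hA, hB⟩ := List.filter_eq_append_iff.1
      (List.take_append_drop (n % (L.filter p).length) (L.filter p)).symm
    rw [← hA, ← hB, ← List.filter_append] at hn
    exact of_isRotated List.isRotated_append (hn.trans List.filter_sublist)
  · rintro ⟨n, hn⟩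
    have := hn.filter p
    simp only [List.filter_cons, hg, hh, if_true, List.filter_nil] at this
    refine of_isRotated ?_ this
    rw [List.rotate_eq_drop_append_take_mod, List.filter_append]
    conv_rhs => rw [← List.take_append_drop (n % L.length) L, List.filter_append]
    exact List.isRotated_append

theorem swap (hL : Alternate L g h) : Alternate L h g := by
  obtain ⟨n, hn⟩ := hL
  obtain ⟨A, B, hAB, hA, hB⟩ := List.append_sublist_iff.1 
    (show List.Sublist ([g] ++ [h, g, h]) (L.rotate n) from hn)
  refine of_isRotated (K := B ++ A) ?_ (hB.append hA)
  exact List.isRotated_append.trans (hAB ▸ List.IsRotated.forall L n)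

theorem map (hL : Alternate L g h) (σ : ι → ι) : Alternate (L.map σ) (σ g) (σ h) := by
  obtain ⟨n, hn⟩ := hL
  exact ⟨n, by simpa [List.map_rotate] using hn.map σ⟩

theorem of_flatMap {R Q : List V} {f : V → List ι} {m : ℕ} (hQ : List.Sublist Q (R.rotate m))
    (h' : List.Sublist [g, h, g, h] (Q.flatMap f)) : Alternate (R.flatMap f) g h := by
  refine of_isRotated (K := (R.rotate m).flatMap f) ?_ (h'.trans (hQ.flatMap f))
  rw [List.rotate_eq_drop_append_take_mod, List.flatMap_append]
  conv_rhs => rw [← List.take_append_drop (m % R.length) R, List.flatMap_append]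
  exact List.isRotated_append

theorem not_of_nodup [DecidableEq ι] (hL : (L.filter (· = g)).Nodup) : ¬ Alternate L g h := by
  rintro ⟨n, hn⟩
  have h₁ : List.Sublist [g, g] (L.rotate n) := by
    refine List.Sublist.trans ?_ hn
    simp
  have h₂ := (List.rotate_perm L n).count_eq g
  have h₃ := h₁.count_le g
  have h₄ := List.nodup_iff_count_le_one.1 hL g
  rw [List.count_filter (by simp)] at h₄
  simp at h₃
  omega

end Alternate

theorem List.exists_rotate_cons {V : Type} {R : List V} {c : V} (hc : c ∈ R) :
    ∃ m A, R.rotate m = c :: A := by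
  obtain ⟨A, B, rfl⟩ := List.append_of_mem hc
  exact ⟨A.length, B ++ A, by simp [List.rotate_append_length_eq]⟩

theorem List.exists_pair_sublist_rotate {V : Type} {R : List V} {c d : V} (hc : c ∈ R) (hd : d ∈ R)
    (hcd : c ≠ d) : ∃ m, List.Sublist [c, d] (R.rotate m) := by
  obtain ⟨m, A, hA⟩ := List.exists_rotate_cons hc
  have : d ∈ R.rotate m := List.mem_rotate.2 hd
  refine ⟨m, ?_⟩
  rw [hA] at this ⊢
  simpa [hcd.symm] using this

theorem List.exists_triple_sublist_rotate {V : Type} {R : List V} {c d e : V} (hc : c ∈ R)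
    (hd : d ∈ R) (he : e ∈ R) (hcd : c ≠ d) (hce : c ≠ e) (hde : d ≠ e) :
    ∃ m, List.Sublist [c, d, e] (R.rotate m) ∨ List.Sublist [c, e, d] (R.rotate m) := by
  obtain ⟨m, A, hA⟩ := List.exists_rotate_cons hc
  have h₁ : d ∈ R.rotate m := List.mem_rotate.2 hd
  have h₂ : e ∈ R.rotate m := List.mem_rotate.2 he
  refine ⟨m, ?_⟩
  rw [hA] at h₁ h₂ ⊢
  simp only [List.mem_cons, hcd.symm, hce.symm, false_or] at h₁ h₂
  exact (Precedes.total h₁ h₂ hde).imp (fun h => h.cons_cons _) fun h => h.cons_cons _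

namespace MLCMInstance

variable {V ι : Type} {M : MLCMInstance V ι} {lay : M.Layout} {g h l : ι} {x y c d : V}

theorem usesEdge.mem_rot (hl : M.usesEdge l x y) : y ∈ M.G.rot x := by
  have hchain := (M.line_path l).2.2
  rw [M.G.rot_mem]
  rcases hl with hl | hl
  · exact List.isChain_pair.1 (hchain.infix hl)
  · exact M.G.symm (List.isChain_pair.1 (hchain.infix hl))

theorem CrossingFree.not_alternate (hlay : CrossingFree lay) (hgh : g ≠ h) :
    ¬ Alternate (cyclicAt lay x) g h := fun h' =>
  hlay g h hgh (Or.inr ⟨x, Or.inl ⟨hgh, h'⟩⟩)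

theorem CrossingFree.feasible (hlay : CrossingFree lay) : Feasible lay := fun _ _ _ h =>
  (hlay.not_alternate h.1 h.2).elim

theorem CrossingFree.not_edge (hlay : CrossingFree lay) (h₁ : Precedes (lay.ord x y) g h) :
    ¬ Precedes (lay.ord y x) g h := fun h₂ =>
  have hne := h₁.ne (lay.nodup x y)
  hlay g h hne (Or.inl ⟨x, y, Or.inl ⟨hne, h₁, h₂⟩⟩)

theorem CrossingFree.ord_reverse (hlay : CrossingFree lay) (x y : V) :
    lay.ord y x = (lay.ord x y).reverse := by
  have hmem : ∀ g, g ∈ lay.ord y x ↔ g ∈ lay.ord x y := fun g => by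
    rw [lay.mem_iff, lay.mem_iff]
    exact ⟨usesEdge_symm, usesEdge_symm⟩
  refine Precedes.ext (lay.nodup _ _) (List.nodup_reverse.2 (lay.nodup _ _)) (by simpa using hmem) ?_
  intro g h hgh
  rw [Precedes.reverse_iff]
  exact (Precedes.total ((hmem _).1 hgh.right_mem) ((hmem _).1 hgh.left_mem)
    (hgh.ne (lay.nodup _ _)).symm).resolve_right (hlay.not_edge hgh)

theorem precedes_mem_rot (h' : Precedes (lay.ord x c) g h) : c ∈ M.G.rot x :=
  ((lay.mem_iff _ _ _).1 h'.left_mem).mem_rot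

theorem CrossingFree.not_vertex (hlay : CrossingFree lay) (hcd : c ≠ d)
    (h₁ : Precedes (lay.ord x c) g h) : ¬ Precedes (lay.ord x d) g h := by
  intro h₂
  obtain ⟨m, hm⟩ := List.exists_pair_sublist_rotate (precedes_mem_rot h₁) (precedes_mem_rot h₂) hcd
  refine hlay.not_alternate (x := x) (h₁.ne (lay.nodup _ _)) (Alternate.of_flatMap hm ?_)
  simpa using h₁.append h₂

/-- Three ports at which two lines appear in the order `g, h`, then `g`, then `h`. -/
theorem CrossingFree.not_diverge (hlay : CrossingFree lay) {m : ℕ} {e : V}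
    (hm : List.Sublist [c, d, e] ((M.G.rot x).rotate m)) (hc : Precedes (lay.ord x c) g h)
    (hd : M.usesEdge g x d) (he : M.usesEdge h x e) : False := by
  refine hlay.not_alternate (x := x) (hc.ne (lay.nodup _ _)) (Alternate.of_flatMap hm ?_)
  have hd' : List.Sublist [g] (lay.ord x d) := by simpa using (lay.mem_iff _ _ _).2 hd
  have he' : List.Sublist [h] (lay.ord x e) := by simpa using (lay.mem_iff _ _ _).2 he
  simpa using hc.append (hd'.append he')

theorem exists_ne_usesEdge (hc : M.usesEdge l x c) (ht : ¬ M.Terminal l x) :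
    ∃ d ≠ c, M.usesEdge l x d := by
  obtain ⟨f, -, hf⟩ := exists_linePath (M := M) (l := l) (Or.inl rfl)
  exact hf.exists_ne_uses hc ht

theorem CrossingFree.split {lay' : M.Layout} (hlay : CrossingFree lay) (hlay' : CrossingFree lay')
    (h₁ : Precedes (lay.ord x c) g h) (h₂ : Precedes (lay'.ord x c) h g) :
    M.Terminal g x ∨ M.Terminal h x ∨ ∃ d ≠ c, M.usesEdge g x d ∧ M.usesEdge h x d := by
  by_contra! hcon
  obtain ⟨htg, hth, hcon⟩ := hcon
  have hg := (lay.mem_iff _ _ _).1 h₁.left_mem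
  have hh := (lay.mem_iff _ _ _).1 h₁.right_mem
  obtain ⟨d, hdc, hd⟩ := exists_ne_usesEdge hg htg
  obtain ⟨e, hec, he⟩ := exists_ne_usesEdge hh hth
  have hde : d ≠ e := by
    rintro rfl
    exact hcon d hdc hd he
  obtain ⟨m, hm | hm⟩ :=
    List.exists_triple_sublist_rotate hg.mem_rot hd.mem_rot he.mem_rot hdc.symm hec.symm hde
  · exact hlay.not_diverge hm h₁ hd he
  · exact hlay'.not_diverge hm h₂ he hd

/-- A line does not alternate with any other line at its terminals. -/
theorem not_alternate_of_terminal (hg : M.Terminal g x) : ¬ Alternate (cyclicAt lay x) g h := by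
  classical
  refine Alternate.not_of_nodup ?_
  rw [cyclicAt, List.filter_flatMap, List.nodup_flatMap]
  refine ⟨fun d _ => (lay.nodup _ _).filter _, ?_⟩
  refine (M.G.rot_nodup x).imp fun {c d} hcd => ?_
  intro l hl hl'
  simp only [List.mem_filter, decide_eq_true_eq, lay.mem_iff] at hl hl'
  obtain ⟨hl, rfl⟩ := hl
  obtain ⟨f, -, hf⟩ := exists_linePath (M := M) (l := l) (Or.inl rfl)
  exact hcd (hf.term_unique hg hl hl'.1)

theorem usesEdge.eq_of_ne (hc : M.usesEdge l x c) (hd : M.usesEdge l x d) (hcd : c ≠ d) {e : V}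
    (hec : e ≠ c) (hed : e ≠ d) : ¬ M.usesEdge l x e := by
  obtain ⟨f, -, hf⟩ := exists_linePath (M := M) (l := l) (Or.inl rfl)
  exact fun he => (hf.degree_le_two hc hd hcd he).elim hec hed

/-- Two lines whose order is reversed at both of their ports at `x` do not cross at `x`. -/
theorem CrossingFree.not_alternate_of_flip {lay' : M.Layout} (hlay : CrossingFree lay)
    (hcd : c ≠ d) (hc : Precedes (lay.ord x c) g h) (hc' : Precedes (lay'.ord x c) h g)
    (hd : Precedes (lay.ord x d) h g) (hd' : Precedes (lay'.ord x d) g h) :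
    ¬ Alternate (cyclicAt lay' x) g h := by
  classical
  have hne := hc.ne (lay.nodup _ _)
  let p : ι → Bool := fun z => z = g ∨ z = h
  have hp : p g ∧ p h := by simp [p]
  have hp' : p = fun z => decide (z = h ∨ z = g) := by
    funext z
    simp only [p, or_comm]
  have key : ∀ e, (lay.ord x e).filter p = ((lay'.ord x e).filter p).map (Equiv.swap g h) := by
    intro e
    by_cases hec : e = c
    · rw [hec, hp', hc'.filter_pair (lay'.nodup _ _), ← hp', hc.filter_pair (lay.nodup _ _)]
      simp
    by_cases hed : e = d
    · rw [hed, hd'.filter_pair (lay'.nodup _ _), hp', hd.filter_pair (lay.nodup _ _)]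
      simp
    have hg : ¬ M.usesEdge g x e := ((lay.mem_iff _ _ _).1 hc.left_mem).eq_of_ne
      ((lay.mem_iff _ _ _).1 hd.right_mem) hcd hec hed
    have hh : ¬ M.usesEdge h x e := ((lay.mem_iff _ _ _).1 hc.right_mem).eq_of_ne
      ((lay.mem_iff _ _ _).1 hd.left_mem) hcd hec hed
    have hp_e : ∀ z, M.usesEdge z x e → p z = false := by
      intro z hz
      simp only [p, decide_eq_false_iff_not]
      rintro (rfl | rfl)
      exacts [hg hz, hh hz]
    have filter_nil : ∀ lay'' : M.Layout, (lay''.ord x e).filter p = [] := by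
      intro lay''
      simpa [List.filter_eq_nil_iff, lay''.mem_iff] using hp_e
    rw [filter_nil, filter_nil, List.map_nil]
  intro halt
  have h₁ := ((Alternate.filter_iff hp.1 hp.2).2 halt).map (Equiv.swap g h)
  rw [Equiv.swap_apply_left, Equiv.swap_apply_right, cyclicAt, List.filter_flatMap,
    List.map_flatMap] at h₁
  simp only [← key] at h₁
  rw [← List.filter_flatMap, Alternate.filter_iff hp.2 hp.1] at h₁
  exact hlay.not_alternate hne.symm h₁

theorem CrossingFree.modify {lay' : M.Layout} (hlay : CrossingFree lay)
    (hrev : ∀ x y, lay'.ord y x = (lay'.ord x y).reverse)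
    (hflip : ∀ x c g h, Precedes (lay.ord x c) g h → Precedes (lay'.ord x c) h g →
      M.Terminal g x ∨ M.Terminal h x ∨
        ∃ d ≠ c, Precedes (lay.ord x d) h g ∧ Precedes (lay'.ord x d) g h) : CrossingFree lay' := by
  classical
  have not_edge : ∀ g h x y, ¬ EdgeCross lay' g h x y := by
    rintro g h x y ⟨-, h₁, h₂⟩
    rw [hrev x y] at h₂
    exact Precedes.asymm (lay'.nodup x y) h₁ (Precedes.reverse_iff.1 h₂)
  have not_vertex : ∀ g h x, ¬ VertexCross lay' g h x := by
    rintro g h x ⟨hne, halt⟩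
    change Alternate (cyclicAt lay' x) g h at halt
    by_cases htg : M.Terminal g x
    · exact not_alternate_of_terminal htg halt
    by_cases hth : M.Terminal h x
    · exact not_alternate_of_terminal hth halt.swap
    by_cases h₁ : ∃ c, Precedes (lay.ord x c) g h ∧ Precedes (lay'.ord x c) h g
    · obtain ⟨c, hc, hc'⟩ := h₁
      obtain ⟨d, hd, hd₁, hd₂⟩ := ((hflip _ _ _ _ hc hc').resolve_left htg).resolve_left hth
      exact hlay.not_alternate_of_flip hd.symm hc hc' hd₁ hd₂ halt
    by_cases h₂ : ∃ c, Precedes (lay.ord x c) h g ∧ Precedes (lay'.ord x c) g h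
    · obtain ⟨c, hc, hc'⟩ := h₂
      obtain ⟨d, hd, hd₁, hd₂⟩ := ((hflip _ _ _ _ hc hc').resolve_left hth).resolve_left htg
      exact hlay.not_alternate_of_flip hd.symm hc hc' hd₁ hd₂ halt.swap
    push Not at h₁ h₂
    let p : ι → Bool := fun z => z = g ∨ z = h
    have hp : p g ∧ p h := by simp [p]
    have key : ∀ e, (lay'.ord x e).filter p = (lay.ord x e).filter p := by
      intro e
      refine (Precedes.ext ((lay.nodup _ _).filter _) ((lay'.nodup _ _).filter _) ?_ ?_).symm
      · intro z
        rw [List.mem_filter, List.mem_filter, lay.mem_iff, lay'.mem_iff]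
      · intro a b hab
        rw [Precedes.filter_iff] at hab ⊢
        refine ⟨?_, hab.2⟩
        have hab_ne := hab.1.ne (lay.nodup _ _)
        refine (Precedes.total ((lay'.mem_iff _ _ _).2 ((lay.mem_iff _ _ _).1 hab.1.left_mem))
          ((lay'.mem_iff _ _ _).2 ((lay.mem_iff _ _ _).1 hab.1.right_mem)) hab_ne).resolve_right ?_
        intro hba
        simp only [p, decide_eq_true_eq] at hab
        obtain ⟨hab, rfl | rfl, rfl | rfl⟩ := hab
        exacts [hab_ne rfl, h₁ e hab hba, h₂ e hab hba, hab_ne rfl]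
    rw [← Alternate.filter_iff hp.1 hp.2, cyclicAt, List.filter_flatMap] at halt
    simp only [key] at halt
    rw [← List.filter_flatMap, Alternate.filter_iff hp.1 hp.2] at halt
    exact hlay.not_alternate hne halt
  rintro g h - (⟨x, y, h' | h'⟩ | ⟨x, h' | h'⟩)
  exacts [not_edge _ _ _ _ h', not_edge _ _ _ _ h', not_vertex _ _ _ h', not_vertex _ _ _ h']

/-- The crossing-free layouts of an instance without nested lines form a line system. -/
theorem ProperLines.lineSystem (hM : M.ProperLines) :
    LineSystem M.usesEdge M.Terminal fun o => ∃ lay : M.Layout, CrossingFree lay ∧ lay.ord = o where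
  exists_path := fun l =>
    have ⟨f, _, hf⟩ := exists_linePath (M := M) (l := l) (Or.inl rfl)
    ⟨_, f, hf⟩
  proper := hM.not_forall_usesEdge
  mem := by
    rintro _ ⟨lay, -, rfl⟩
    exact lay.mem_iff
  nodup := by
    rintro _ ⟨lay, -, rfl⟩
    exact lay.nodup
  rev := by
    rintro _ ⟨lay, hlay, rfl⟩
    exact hlay.ord_reverse
  pass := by
    rintro _ ⟨lay, hlay, rfl⟩ x c d g h hgc hhc hgd hhd hcd hgh
    refine (Precedes.total ((lay.mem_iff _ _ _).2 hgd) ((lay.mem_iff _ _ _).2 hhd)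
      (hgh.ne (lay.nodup _ _))).resolve_right fun hhg => ?_
    rw [hlay.ord_reverse x c, Precedes.reverse_iff] at hgh
    exact hlay.not_vertex hcd hgh hhg
  split := by
    rintro _ _ ⟨lay, hlay, rfl⟩ ⟨lay', hlay', rfl⟩ x c g h h₁ h₂
    exact hlay.split hlay' h₁ h₂
  modify := by
    rintro _ o' ⟨lay, hlay, rfl⟩ hperm hrev hflip
    let lay' : M.Layout :=
      { ord := o'
        nodup := fun x y => (hperm x y).nodup_iff.2 (lay.nodup x y)
        mem_iff := fun x y l => (hperm x y).mem_iff.trans (lay.mem_iff x y l) }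
    exact ⟨lay', hlay.modify (lay' := lay') hrev hflip, rfl⟩

end MLCMInstance

namespace MLCMInstance

variable {V ι : Type} {M : MLCMInstance V ι} {i j l : ι} {P : List V} {u v x y : V}

theorem InfixOf.usesEdge (hP : M.InfixOf l P) (hxy : [x, y] <:+: P) : M.usesEdge l x y := by
  rcases hP with hP | hP
  · exact Or.inl (hxy.trans hP)
  · exact Or.inr ((by simpa using List.reverse_infix.2 hxy : [y, x] <:+: P.reverse).trans hP)

/-- The common subpath of an overlapping pair is an initial part of the first line. -/
theorem OverlappingPair.exists_linePath (h : M.OverlappingPair i j P u v) :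
    ∃ (N : ℕ) (β : ℕ → V), LinePath (M.usesEdge i) (M.Terminal i) N β ∧ 2 ≤ P.length ∧
      P.length ≤ N + 1 ∧ (∀ k < P.length, P[k]? = some (β k)) ∧
      M.Terminal j (β (P.length - 1)) := by
  obtain ⟨-, ⟨⟨h2, hiP, -⟩, -⟩, hu, hv, hTi, hTj, -, -⟩ := h
  obtain ⟨p, hp, hPp⟩ : ∃ p, (p = M.line i ∨ p = (M.line i).reverse) ∧ P <:+: p := by
    rcases hiP with hP | hP
    · exact ⟨_, Or.inl rfl, hP⟩
    · exact ⟨_, Or.inr rfl, by simpa using List.reverse_infix.2 hP⟩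
  obtain ⟨f, hf, hpath⟩ := MLCMInstance.exists_linePath hp
  obtain ⟨c, hc, hP⟩ := List.shift_of_infix hf hPp
  have hc0 : c = 0 := by
    rw [List.head?_eq_getElem?, hP 0 (by omega), Option.some.injEq] at hu
    rw [← hu] at hTi
    rcases (hpath.term _).1 hTi with h | h
    · exact hpath.inj (by omega) (Nat.zero_le _) h
    · have := hpath.inj (by omega) le_rfl h
      omega
  subst hc0
  simp only [zero_add] at hP
  refine ⟨_, f, hpath, h2, by omega, hP, ?_⟩
  rw [List.getLast?_eq_getElem?, hP _ (by omega), Option.some.injEq] at hv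
  rwa [hv]

theorem exists_adjacent [Finite ι] (hM : M.ProperLines) (hover : M.OverlappingPair i j P u v)
    (hnosep : ∀ l, ¬ M.Separator i j P l) {lay : M.Layout} (hlay : CrossingFree lay) :
    ∃ lay' : M.Layout, CrossingFree lay' ∧
      ∀ x y, [x, y] <:+: P → [j, i] <:+: lay'.ord x y ∨ [j, i] <:+: lay'.ord y x := by
  obtain ⟨N, β, hβ, h2, hN, hP, hTj⟩ := hover.exists_linePath
  have hij := hover.1
  have hjP := hover.2.1.1.2.2
  have H := hM.lineSystem
  have hsub : ∀ k < P.length - 1, [β k, β (k + 1)] <:+: P := fun k hk =>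
    (List.pair_infix_iff hP).2 ⟨k, by omega, rfl, rfl⟩
  have hUj : ∀ k < P.length - 1, M.usesEdge j (β k) (β (k + 1)) := fun k hk =>
    hjP.usesEdge (hsub k hk)
  have hS : ∀ {lay : M.Layout}, CrossingFree lay →
      ∃ lay' : M.Layout, CrossingFree lay' ∧ lay'.ord = lay.ord := fun h => ⟨_, h, rfl⟩
  rcases H.total (hS hlay) (hβ.uses_succ (k := 0) (by omega)) (hUj 0 (by omega)) hij with h | h
  · obtain ⟨_, ⟨lay', hlay', rfl⟩, hadj⟩ := H.exists_adjacent hβ (hS hlay)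
      (n := P.length - 1) (by omega) (by omega) hTj hUj h fun l k hk h₁ h₂ =>
        hnosep l ⟨((h₁ _ (hS hlay)).ne (lay.nodup _ _)).symm, (h₂ _ (hS hlay)).ne (lay.nodup _ _),
          _, _, hsub k hk, Or.inl ⟨fun _ _ h => h₁ _ (hS h), fun _ _ h => h₂ _ (hS h)⟩⟩
    refine ⟨lay', hlay', fun x y hxy => ?_⟩
    obtain ⟨k, hk, rfl, rfl⟩ := (List.pair_infix_iff hP).1 hxy
    exact Or.inl (hadj k (by omega))
  · obtain ⟨o', ⟨lay', hlay', hord⟩, hadj⟩ := H.swap.exists_adjacent hβ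
      (o := fun x y => lay.ord y x) (hS hlay)
      (n := P.length - 1) (by omega) (by omega) hTj hUj ((H.precedes_rev (hS hlay)).2 h)
      fun l k hk h₁ h₂ =>
        have h₁' {lay : M.Layout} (h : CrossingFree lay) :=
          (H.precedes_rev (hS h)).1 (h₁ (fun x y => lay.ord y x) (hS h))
        have h₂' {lay : M.Layout} (h : CrossingFree lay) :=
          (H.precedes_rev (hS h)).1 (h₂ (fun x y => lay.ord y x) (hS h))
        hnosep l ⟨(h₁' hlay).ne (lay.nodup _ _), ((h₂' hlay).ne (lay.nodup _ _)).symm,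
          _, _, hsub k hk, Or.inr ⟨fun _ _ h => h₂' h, fun _ _ h => h₁' h⟩⟩
    refine ⟨lay', hlay', fun x y hxy => ?_⟩
    obtain ⟨k, hk, rfl, rfl⟩ := (List.pair_infix_iff hP).1 hxy
    have := hadj k (by omega)
    rw [hord]
    exact Or.inr this

end MLCMInstance

open MLCMInstance in
/-- In an instance of MLCM in which no line is a subpath of
another line, let `i, j` be an overlapping pair of lines without a separator
whose common subpath `P` has the minimum number of edges among all such pairs.
If the instance admits a crossing-free solution, then it admits a
crossing-free solution in which `i` and `j` are immediate neighbours in the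
line orders on every edge of `P`. -/
theorem mlcm_merge_overlapping_pair_without_separator
    {V ι : Type} [Fintype ι] (M : MLCMInstance V ι)
    (hproper : M.ProperLines)
    (i j : ι) (P : List V) (u v : V)
    (hover : M.OverlappingPair i j P u v)
    (hnosep : ∀ l, ¬ M.Separator i j P l)
    (hmin : ∀ (i' j' : ι) (P' : List V) (u' v' : V),
      M.OverlappingPair i' j' P' u' v' → (∀ l, ¬ M.Separator i' j' P' l) →
      P.length ≤ P'.length)
    (hex : ∃ lay : M.Layout, Feasible lay ∧ CrossingFree lay) :
    ∃ lay : M.Layout, Feasible lay ∧ CrossingFree lay ∧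
      ∀ a b : V, [a, b] <:+: P →
        (([i, j] <:+: lay.ord a b ∨ [j, i] <:+: lay.ord a b) ∧
         ([i, j] <:+: lay.ord b a ∨ [j, i] <:+: lay.ord b a)) := by
  obtain ⟨lay₀, -, hlay₀⟩ := hex
  obtain ⟨lay, hlay, hadj⟩ := exists_adjacent hproper hover hnosep hlay₀
  have rev_infix : ∀ {x y : V}, [j, i] <:+: lay.ord x y → [i, j] <:+: lay.ord y x := by
    intro x y h
    rw [hlay.ord_reverse x y]
    simpa using List.reverse_infix.2 h
  refine ⟨lay, hlay.feasible, hlay, fun a b hab => ?_⟩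
  rcases hadj a b hab with h | h
  · exact ⟨Or.inr h, Or.inl (rev_infix h)⟩
  · exact ⟨Or.inl (rev_infix h), Or.inr h⟩
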